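/- Consider gradient descent θ_{k+1} = θ_k − η∇f(θ_k) on the square-loss deep linear training loss f with input dimension d_0 > 1, initialized by random balanced initialization: sample A from a probability measure P on ℝ^{1×d_0} that assigns probability zero to every set of Lebesgue measure zero and satisfies P(‖A‖_F ≤ 0.2) = 1, take a singular value decomposition A = UΣVᵀ (U and V with orthonormal columns, Σ diagonal holding the singular values), and set W_n ≃ UΣ^{1/n}, W_j ≃ Σ^{1/n} for j = 2,…,n−1, and W_1 ≃ Σ^{1/n}Vᵀ, where ≃ means equality up to zero-valued padding. Then with probability one over the initialization: for every ε̃ > 0, if η ≤ ( ‖W_{n:1,0}‖_F⁵ · min{1, ε̃} ) / ( n^{17/2} · e^{7n+6} · (max{1, (1−ν)/(1+ν)})^{(11n−5)/2} ) · ( ln( 15n·max{1, (1−ν)/(1+ν)} / (‖W_{n:1,0}‖_F·min{1, ε̃}) ) )^{−2}, where W_{n:1,0} is the initial end-to-end matrix and ν := Tr(Λ_yxᵀ W_{n:1,0})/(‖Λ_yx‖_F·‖W_{n:1,0}‖_F), then f(θ_k) − min_{q∈ℝ^d} f(q) ≤ ε̃ for k = ⌊ (2n·(max{1, (3/2)·(1−ν)/(1+ν)})^n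 / (‖W_{n:1,0}‖_F·η)) · ln( 15n·max{1, (1−ν)/(1+ν)} / (‖W_{n:1,0}‖_F·min{1, ε̃}) ) + 1 ⌋. -/

import Mathlib

open scoped RealInnerProductSpace
open Matrix

noncomputable section

/-- The family of weight matrices of a depth-`n` fully connected network with layer widths
`dims 0, dims 1, …, dims n`: `W j` maps `ℝ^{dims j}` to `ℝ^{dims (j+1)}` (zero-indexed). -/
abbrev WeightFam (n : ℕ) (dims : ℕ → ℕ) : Type :=
  ∀ j : Fin n, Matrix (Fin (dims (j.val + 1))) (Fin (dims j.val)) ℝ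

/-- Rectangular matrix with ones on the diagonal: equals the identity matrix whenever the
two dimensions coincide. -/
def castId (p q : ℕ) : Matrix (Fin p) (Fin q) ℝ :=
  Matrix.of fun i j => if (i : ℕ) = (j : ℕ) then 1 else 0

/-- `segProd dims W a b = W_{b-1} * ⋯ * W_a` (zero-indexed), the identity when `a = b`.
This realizes the paper's product `W_{b : a+1}` (one-indexed), empty products being
identity matrices. -/
def segProd {n : ℕ} (dims : ℕ → ℕ) (W : WeightFam n dims) (a : ℕ) :
    (b : ℕ) → Matrix (Fin (dims b)) (Fin (dims a)) ℝ
  | 0 => castId (dims 0) (dims a)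
  | b + 1 =>
      if a = b + 1 then castId (dims (b + 1)) (dims a)
      else if hb : b < n then W ⟨b, hb⟩ * segProd dims W a b else 0

/-- Frobenius norm of a matrix. -/
def frobNorm {p q : ℕ} (M : Matrix (Fin p) (Fin q) ℝ) : ℝ :=
  Real.sqrt (∑ i, ∑ j, M i j ^ 2)

/-- A weight setting is balanced when `W_{j+1}ᵀ W_{j+1} = W_j W_jᵀ` for all adjacent
pairs of layers. -/
def IsBalanced {n : ℕ} (dims : ℕ → ℕ) (W : WeightFam n dims) : Prop :=
  ∀ (j : ℕ) (hj : j + 1 < n),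
    (W ⟨j + 1, hj⟩)ᵀ * W ⟨j + 1, hj⟩ =
      W ⟨j, Nat.lt_of_succ_lt hj⟩ * (W ⟨j, Nat.lt_of_succ_lt hj⟩)ᵀ

/-- The Hessian of `f` at `x`, regarded as a quadratic form, evaluated at `v`. -/
def hessQ {E : Type*} [NormedAddCommGroup E] [InnerProductSpace ℝ E] [CompleteSpace E]
    (f : E → ℝ) (x v : E) : ℝ :=
  ⟪v, fderiv ℝ (gradient f) x v⟫

/-- The iterates of gradient descent with step size `η` started at `θ0`. -/
def gdIter {E : Type*} [NormedAddCommGroup E] [InnerProductSpace ℝ E] [CompleteSpace E]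
    (f : E → ℝ) (η : ℝ) (θ0 : E) : ℕ → E
  | 0 => θ0
  | k + 1 => gdIter f η θ0 k - η • gradient f (gdIter f η θ0 k)

open MeasureTheory

/-- The space of `p × q` real matrices regarded as a Euclidean space (so that the Euclidean
norm is the Frobenius norm). -/
abbrev MatE (p q : ℕ) : Type := EuclideanSpace ℝ (Fin p × Fin q)

/-- Conversion from the Euclidean representation to the matrix itself. -/
def toMat {p q : ℕ} (w : MatE p q) : Matrix (Fin p) (Fin q) ℝ :=
  Matrix.of fun i j => w (i, j)

/-- Padding of a matrix by zeros into a (possibly) larger format. -/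
def padTL {a b : ℕ} (p q : ℕ) (M : Matrix (Fin a) (Fin b) ℝ) : Matrix (Fin p) (Fin q) ℝ :=
  Matrix.of fun i j =>
    if h : (i : ℕ) < a ∧ (j : ℕ) < b then M ⟨i, h.1⟩ ⟨j, h.2⟩ else 0

/-- Entrywise real power of a matrix (used to form `Σ^{1/n}` for a diagonal matrix of
singular values). -/
def rpowMat {a b : ℕ} (M : Matrix (Fin a) (Fin b) ℝ) (e : ℝ) : Matrix (Fin a) (Fin b) ℝ :=
  Matrix.of fun i j => M i j ^ e

theorem pow_le_three_halves {n : ℕ} (hn : 0 < n) {a : ℝ} (ha : 0 < a)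
    (ha' : a ≤ 1 + 1 / (4 * (n : ℝ))) {k : ℕ} (hk : k ≤ n) : a ^ k ≤ 3 / 2 := by
  have hn' : (0 : ℝ) < n := by exact_mod_cast hn
  rcases le_total a 1 with h | h
  · linarith [pow_le_one₀ ha.le h (n := k)]
  · have h1 : a ≤ Real.exp (1 / (4 * (n : ℝ))) := by
      linarith [Real.add_one_le_exp (1 / (4 * (n : ℝ)))]
    calc a ^ k ≤ a ^ n := pow_le_pow_right₀ h hk
      _ ≤ Real.exp (1 / (4 * (n : ℝ))) ^ n := pow_le_pow_left₀ ha.le h1 n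
      _ = Real.exp (1 / 4) := by
        rw [← Real.exp_nat_mul]; congr 1; field_simp
      _ ≤ 3 / 2 := by
        have := Real.exp_one_lt_d9
        have h2 : Real.exp (1 / 4) ^ 4 = Real.exp 1 := by
          rw [← Real.exp_nat_mul]; congr 1; norm_num
        by_contra! h3
        have : (3 / 2 : ℝ) ^ 4 < Real.exp (1 / 4) ^ 4 :=
          pow_lt_pow_left₀ h3 (by norm_num) (by norm_num)
        linarith

/-- The defect `D` of balancedness drifts by `O(η²)` per step. -/
theorem abs_balance_drift_le {a p D δ c : ℝ} (ha : 0 < a) (ha' : a ≤ 5 / 4) (hc : 0 < c)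
    (hc2 : c ≤ 2) (hca : c * a ≤ 2) (hv : -δ ≤ a - p) (hv' : a - p ≤ 2)
    (hD : |D| ≤ δ) (hδ : δ ≤ 1 / 1000) :
    |(c * a) ^ 2 * ((c * a) ^ 2 * (a ^ 2 + D) - 2 * (c * a) * p + 1) -
      (c * (c * a * (a ^ 2 + D) - p)) ^ 2| ≤ 400 := by
  obtain ⟨hD1, hD2⟩ := abs_le.1 hD
  have hca0 : 0 < c * a := by positivity
  have h0 : |c * a| ≤ 2 := abs_le.2 ⟨by linarith, hca⟩
  have hr : |a ^ 2 + D| ≤ 2 := abs_le.2 ⟨by nlinarith, by nlinarith⟩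
  have hp : |p| ≤ 2 := abs_le.2 ⟨by linarith, by linarith⟩
  have hc' : |c| ≤ 2 := abs_le.2 ⟨by linarith, hc2⟩
  have e1 : |c * a * (a ^ 2 + D)| ≤ 4 := by
    rw [abs_mul]; nlinarith [abs_nonneg (c * a), abs_nonneg (a ^ 2 + D)]
  have e2 : |c * a * p| ≤ 4 := by
    rw [abs_mul]; nlinarith [abs_nonneg (c * a), abs_nonneg p]
  have e3 : |c * (c * a * (a ^ 2 + D) - p)| ≤ 12 := by
    rw [abs_mul]
    have := abs_sub (c * a * (a ^ 2 + D)) p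
    nlinarith [abs_nonneg c, abs_nonneg (c * a * (a ^ 2 + D) - p)]
  have e4 : |c * a * (c * a * (a ^ 2 + D))| ≤ 8 := by
    rw [abs_mul]; nlinarith [abs_nonneg (c * a), abs_nonneg (c * a * (a ^ 2 + D))]
  have e5 : |(c * a) ^ 2 * (a ^ 2 + D) - 2 * (c * a) * p + 1| ≤ 17 := by
    rw [abs_le] at *
    constructor <;> nlinarith
  have e6 : (c * a) ^ 2 ≤ 4 := by nlinarith
  have e7 : |(c * a) ^ 2 * ((c * a) ^ 2 * (a ^ 2 + D) - 2 * (c * a) * p + 1)| ≤ 68 := by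
    rw [abs_mul, abs_of_nonneg (sq_nonneg (c * a))]
    nlinarith [abs_nonneg ((c * a) ^ 2 * (a ^ 2 + D) - 2 * (c * a) * p + 1)]
  have e8 : (c * (c * a * (a ^ 2 + D) - p)) ^ 2 ≤ 144 := by
    rw [← sq_abs]; nlinarith [abs_nonneg (c * (c * a * (a ^ 2 + D) - p))]
  rw [abs_le] at e7 ⊢
  constructor <;> nlinarith [sq_nonneg (c * (c * a * (a ^ 2 + D) - p))]

/-- One step for `v = a - p`. -/
theorem diff_step {h B b D δ v : ℝ} (hh : 0 ≤ h) (hB : 0 ≤ B) (hb : 0 ≤ b) (hbB : b ≤ 1 + B)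
    (hstep : h * (1 + B) ≤ 1) (hD : |D| ≤ δ) (hδ : δ ≤ 1) (hv : -δ ≤ v) (hv' : v ≤ 2) :
    -δ ≤ v - h * ((1 + B) * v + b * D) ∧ v - h * ((1 + B) * v + b * D) ≤ 2 := by
  obtain ⟨hD1, hD2⟩ := abs_le.1 hD
  have hδ0 : 0 ≤ δ := by linarith
  have k1 : b * D ≤ (1 + B) * δ := by nlinarith
  have k2 : -((1 + B) * δ) ≤ b * D := by nlinarith
  constructor
  · nlinarith [mul_le_mul_of_nonneg_left k1 hh,
      mul_nonneg (sub_nonneg.2 hstep) (by linarith : 0 ≤ v + δ)]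
  · nlinarith [mul_le_mul_of_nonneg_left k2 hh,
      mul_nonneg (sub_nonneg.2 hstep) (by linarith : 0 ≤ 2 - v),
      mul_nonneg hh (by nlinarith : 0 ≤ (1 + B) * (1 - δ))]

/-- One step of the exponential decay of `|1 - a| + 4 |a - p|`. -/
theorem potential_step {a v c h S D δ : ℝ} (ha : 0 < a) (ha' : a ≤ 5 / 4) (hc : 0 ≤ c) (hc2 : c ≤ 2)
    (hh : 0 ≤ h) (hS : 1 ≤ S) (hhS : h * a * S ≤ 1) (hstep : h * (1 + c * a ^ 2) ≤ 1)
    (hfac : 1 - c * a ^ 2 = S * (1 - a)) (hD : |D| ≤ δ) :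
    |1 - (a + h * (a * (1 - c * a ^ 2) - v - c * a * D))| +
        4 * |v - h * ((1 + c * a ^ 2) * v + c * a * D)| ≤
      (1 - h * a / 2) * (|1 - a| + 4 * |v| - 20 * δ) + 20 * δ := by
  have hδ0 : 0 ≤ δ := (abs_nonneg D).trans hD
  have hcaD : |c * a * D| ≤ 2 * a * δ := by
    rw [abs_mul, abs_of_nonneg (by positivity : 0 ≤ c * a)]
    have : c * a ≤ 2 * a := by nlinarith
    exact mul_le_mul this hD (abs_nonneg D) (by positivity)
  have e1 : |1 - (a + h * (a * (1 - c * a ^ 2) - v - c * a * D))| ≤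
      (1 - h * a) * |1 - a| + h * |v| + h * (2 * a * δ) := by
    have : 1 - (a + h * (a * (1 - c * a ^ 2) - v - c * a * D)) =
        (1 - h * a * S) * (1 - a) + h * v + h * (c * a * D) := by
      rw [hfac]; ring
    rw [this]
    have t := abs_add_three ((1 - h * a * S) * (1 - a)) (h * v) (h * (c * a * D))
    rw [abs_mul, abs_mul, abs_mul h (c * a * D), abs_of_nonneg hh,
      abs_of_nonneg (by linarith : 0 ≤ 1 - h * a * S)] at t
    have t1 : (1 - h * a * S) * |1 - a| ≤ (1 - h * a) * |1 - a| := by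
      refine mul_le_mul_of_nonneg_right ?_ (abs_nonneg _)
      nlinarith [mul_nonneg hh ha.le]
    have t2 := mul_le_mul_of_nonneg_left hcaD hh
    linarith
  have e2 : |v - h * ((1 + c * a ^ 2) * v + c * a * D)| ≤ (1 - h) * |v| + h * (2 * a * δ) := by
    have : v - h * ((1 + c * a ^ 2) * v + c * a * D) =
        (1 - h * (1 + c * a ^ 2)) * v - h * (c * a * D) := by ring
    rw [this]
    have t := abs_sub ((1 - h * (1 + c * a ^ 2)) * v) (h * (c * a * D))
    rw [abs_mul, abs_mul h (c * a * D), abs_of_nonneg hh,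
      abs_of_nonneg (by linarith : 0 ≤ 1 - h * (1 + c * a ^ 2))] at t
    have t1 : (1 - h * (1 + c * a ^ 2)) * |v| ≤ (1 - h) * |v| := by
      refine mul_le_mul_of_nonneg_right ?_ (abs_nonneg _)
      have : 0 ≤ h * (c * a ^ 2) := by positivity
      nlinarith
    have t2 := mul_le_mul_of_nonneg_left hcaD hh
    linarith
  have e3 : h * a * |v| ≤ 5 / 4 * (h * |v|) := by
    nlinarith [mul_nonneg hh (abs_nonneg v)]
  have e4 : 0 ≤ h * a * |1 - a| := by positivity
  have e5 : 0 ≤ h * |v| := by positivity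
  nlinarith

theorem upper_step {a v c h S D δ w : ℝ} (ha : 0 < a) (ha' : a ≤ 1 + w) (hca : c * a ≤ 2)
    (hc : 0 ≤ c) (hh : 0 ≤ h) (hh1 : h ≤ 1) (hS : 1 ≤ S) (hhS : h * a * S ≤ 1)
    (hfac : 1 - c * a ^ 2 = S * (1 - a)) (hD : |D| ≤ δ) (hv : -δ ≤ v) (hδ : 3 * δ ≤ w) :
    a + h * (a * (1 - c * a ^ 2) - v - c * a * D) ≤ 1 + w := by
  have hδ0 : 0 ≤ δ := (abs_nonneg D).trans hD
  obtain ⟨hD1, hD2⟩ := abs_le.1 hD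
  have hcaD : -(2 * δ) ≤ c * a * D := by nlinarith [mul_nonneg hc ha.le]
  have e1 : h * (-v - c * a * D) ≤ h * (3 * δ) :=
    mul_le_mul_of_nonneg_left (by linarith) hh
  have : a + h * (a * (1 - c * a ^ 2) - v - c * a * D) =
      1 + (1 - h * a * S) * (a - 1) + h * (-v - c * a * D) := by rw [hfac]; ring
  rw [this]
  rcases le_total a 1 with h1 | h1
  · have : h * (3 * δ) ≤ 1 * w := mul_le_mul hh1 hδ (by linarith) zero_le_one
    nlinarith [mul_nonneg (sub_nonneg.2 hhS) (sub_nonneg.2 h1)]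
  · have e2 : (1 - h * a * S) * (a - 1) ≤ (1 - h * a * S) * w :=
      mul_le_mul_of_nonneg_left (by linarith) (by linarith)
    have e3 : h * (3 * δ) ≤ h * (a * S * w) := by
      refine mul_le_mul_of_nonneg_left ?_ hh
      have : 1 ≤ a * S := by nlinarith
      nlinarith
    linarith

/-- The angle condition `a ≤ 5 p` and the lower bound `α ≤ a` persist together. -/
theorem aligned_step {n : ℕ} {a p c h D δ α : ℝ} (hα : 0 < α) (ha : α ≤ a) (hc : 0 ≤ c)
    (hc2 : c ≤ 2) (hB : c * a ^ 2 = a ^ n) (hB2 : a ^ n ≤ 3 / 2) (hh : 0 ≤ h)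
    (hhn : h * n ≤ 1 / 1000) (hh1 : h ≤ 1 / 1000) (hD : |D| ≤ δ) (hδ : δ ≤ 1 / 1000) (hδα : δ ≤ α)
    (hv : -δ ≤ a - p) (hp : a ≤ 5 * p) (hαn : α ^ n ≤ 3 / 20) :
    α ≤ a + h * (p - a * (c * a ^ 2) - c * a * D) ∧
      a + h * (p - a * (c * a ^ 2) - c * a * D) ≤ 5 * (p + h * (a - c * a ^ 2 * p)) := by
  have hδ0 : 0 ≤ δ := (abs_nonneg D).trans hD
  have ha0 : 0 < a := by linarith
  obtain ⟨hD1, hD2⟩ := abs_le.1 hD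
  have hcD : c * D ≤ 2 * δ := by nlinarith
  have hcD' : -(2 * δ) ≤ c * D := by nlinarith
  constructor
  · by_contra! hlt
    have e1 : a * (1 - 2 * h) ≤ a + h * (p - a * (c * a ^ 2) - c * a * D) := by
      have : -2 * a ≤ p - a * (c * a ^ 2) - c * a * D := by
        rw [hB]
        nlinarith
      nlinarith
    have e2 : (a * (1 - 2 * h)) ^ n ≤ 3 / 20 :=
      (pow_le_pow_left₀ (mul_nonneg ha0.le (by linarith)) (e1.trans hlt.le) n).trans hαn
    have e3 : 1 + (n : ℝ) * (-(2 * h)) ≤ (1 + -(2 * h)) ^ n :=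
      one_add_mul_le_pow (by linarith) n
    rw [mul_pow] at e2
    have e4 : (99 / 100 : ℝ) ≤ (1 - 2 * h) ^ n := by
      rw [sub_eq_add_neg]; linarith
    have hp0 : 0 ≤ a ^ n := by positivity
    have e5 : a ^ n ≤ 19 / 100 := by nlinarith
    have : 0 ≤ p - a * (c * a ^ 2) - c * a * D := by rw [hB]; nlinarith
    nlinarith [mul_nonneg hh this]
  · have hB1 : h * (c * a ^ 2) ≤ 1 := by rw [hB]; nlinarith
    have e1 : 0 ≤ h * (5 * a - p + c * a * D) := by
      refine mul_nonneg hh ?_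
      nlinarith
    nlinarith [mul_nonneg (sub_nonneg.2 hp) (sub_nonneg.2 hB1)]

theorem sq_mul_le_cube {a p : ℝ} (hu : 0 ≤ a + p) (hp : 5 * p ≤ a) :
    (a + p) ^ 2 * (a - p) ≤ 144 / 125 * a ^ 3 := by
  have ha : 0 ≤ a := by linarith
  have h1 : 0 ≤ (a + p) * (a / 5 - p) := mul_nonneg hu (by linarith)
  have h2 : 0 ≤ a * (14 / 25 * a - 2 / 5 * p) := mul_nonneg ha (by linarith)
  have h3 : 0 ≤ (a / 5 - p) * ((a + p) * (a / 5 - p) + a * (14 / 25 * a - 2 / 5 * p)) :=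
    mul_nonneg (by linarith) (by linarith)
  nlinarith

theorem one_add_pow_le {n : ℕ} {h : ℝ} (hh : 0 ≤ h) (hh1 : h ≤ 1 / 1000)
    (hhn : h * n ≤ 1 / 1000) : (1 + h) ^ n ≤ 1001 / 999 := by
  have e3 : 1 + (n : ℝ) * (-h) ≤ (1 + -h) ^ n := one_add_mul_le_pow (by linarith) n
  have e6 : 0 ≤ (1 + h) * (1 + -h) := mul_nonneg (by linarith) (by linarith)
  have e7 : (1 + h) * (1 + -h) ≤ 1 := by linarith [mul_self_nonneg h]
  have e4 : (1 + h) ^ n * (1 + -h) ^ n ≤ 1 := by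
    rw [← mul_pow]
    exact pow_le_one₀ e6 e7
  have e5 : 0 ≤ (1 + h) ^ n := by positivity
  nlinarith

theorem one_le_sq_mul {h : ℝ} (hh : 0 ≤ h) (hh1 : h ≤ 1 / 1000) :
    1 ≤ (1 + 7 / 10 * h) ^ 2 * (1 - 13 / 10 * h) := by
  nlinarith [mul_nonneg hh (sub_nonneg.2 hh1), mul_nonneg (mul_nonneg hh hh) (sub_nonneg.2 hh1)]

/-- While the angle condition `a ≤ 5 p` fails, `(a + p)² (a - p)` does not decrease. -/
theorem unaligned_step {n : ℕ} {a p c h D δ u₀ F : ℝ} (ha : 0 < a) (ha1 : a ≤ 1) (hc : 0 ≤ c)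
    (hc1 : c ≤ 1) (hB : c * a ^ 2 = a ^ n) (hB2 : a ^ n ≤ 21 / 100) (hh : 0 ≤ h)
    (hhn : h * n ≤ 1 / 1000) (hh1 : h ≤ 1 / 1000) (hD : |D| ≤ δ) (hδ : δ ≤ 1 / 1000)
    (hδu : 100 * δ ≤ u₀) (hu₀ : 0 < u₀) (hu : u₀ ≤ a + p) (hp : 5 * p < a)
    (hF : F ≤ (a + p) ^ 2 * (a - p)) :
    a * (1 - 2 * h) ≤ a + h * (p - a * (c * a ^ 2) - c * a * D) ∧
    (a + h * (p - a * (c * a ^ 2) - c * a * D)) ^ n ≤ 21 / 100 ∧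
    u₀ ≤ (a + p) + h * ((1 - c * a ^ 2) * (a + p) - c * a * D) ∧
    F ≤ ((a + p) + h * ((1 - c * a ^ 2) * (a + p) - c * a * D)) ^ 2 *
      ((a - p) - h * ((1 + c * a ^ 2) * (a - p) + c * a * D)) := by
  have hδ0 : 0 ≤ δ := (abs_nonneg D).trans hD
  obtain ⟨hD1, hD2⟩ := abs_le.1 hD
  have hca : 0 ≤ c * a := by positivity
  have hca1 : c * a ≤ 1 := by nlinarith
  have hcD : c * D ≤ δ := by nlinarith
  have hcD' : -δ ≤ c * D := by nlinarith
  have hcaD : c * a * D ≤ δ := by nlinarith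
  have hcaD' : -δ ≤ c * a * D := by nlinarith
  have hcaDa : -(a * δ) ≤ c * a * D := by nlinarith
  have hp0 : 0 ≤ a ^ n := by positivity
  have hap0 : 0 ≤ a * a ^ n := by positivity
  have hn0 : (0 : ℝ) ≤ n := by positivity
  rw [hB]
  have e0 : a * (1 - 2 * h) ≤ a + h * (p - a * a ^ n - c * a * D) := by
    have : -2 * a ≤ p - a * a ^ n - c * a * D := by
      have : a * a ^ n ≤ a * (21 / 100) := mul_le_mul_of_nonneg_left hB2 ha.le
      have : c * a * D ≤ a * δ := by nlinarith
      have : a * δ ≤ a * (1 / 1000) := mul_le_mul_of_nonneg_left hδ ha.le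
      linarith
    linarith [mul_le_mul_of_nonneg_left this hh]
  set u := a + p with hudef
  set v := a - p with hvdef
  have huv : 2 * u < 3 * v := by simp only [hudef, hvdef]; linarith
  have eu : u * (1 + 7 / 10 * h) ≤ u + h * ((1 - a ^ n) * u - c * a * D) := by
    have : 7 / 10 * u ≤ (1 - a ^ n) * u - c * a * D := by nlinarith
    linarith [mul_le_mul_of_nonneg_left this hh]
  have ev : v * (1 - 13 / 10 * h) ≤ v - h * ((1 + a ^ n) * v + c * a * D) := by
    have : (1 + a ^ n) * v + c * a * D ≤ 13 / 10 * v := by nlinarith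
    linarith [mul_le_mul_of_nonneg_left this hh]
  have hu0 : 0 < u := by linarith
  have hv0 : 0 < v := by linarith
  refine ⟨e0, ?_, ?_, ?_⟩
  · by_cases hlow : a ^ n ≤ 205 / 1000
    · have e1 : a + h * (p - a * a ^ n - c * a * D) ≤ a * (1 + h) := by
        have : p - a * a ^ n - c * a * D ≤ a := by
          have : a * δ ≤ a * (1 / 1000) := mul_le_mul_of_nonneg_left hδ ha.le
          linarith
        linarith [mul_le_mul_of_nonneg_left this hh]
      have e2 : (1 + h) ^ n ≤ 1001 / 999 := one_add_pow_le hh hh1 hhn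
      calc _ ≤ (a * (1 + h)) ^ n :=
            pow_le_pow_left₀ ((mul_nonneg ha.le (by linarith)).trans e0) e1 n
        _ = a ^ n * (1 + h) ^ n := mul_pow _ _ _
        _ ≤ 205 / 1000 * (1001 / 999) := mul_le_mul hlow e2 (by positivity) (by norm_num)
        _ ≤ _ := by norm_num
    · push Not at hlow
      refine le_trans (pow_le_pow_left₀ ((mul_nonneg ha.le (by linarith)).trans e0) ?_ n) hB2
      have : p - a * a ^ n - c * a * D ≤ 0 := by
        have h1 : a * δ ≤ a * (1 / 1000) := mul_le_mul_of_nonneg_left hδ ha.le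
        have h2 : a * (205 / 1000) ≤ a * a ^ n := mul_le_mul_of_nonneg_left hlow.le ha.le
        linarith
      linarith [mul_nonneg hh (sub_nonneg.2 this)]
  · refine le_trans ?_ eu
    linarith [mul_nonneg hu0.le hh]
  · refine hF.trans ?_
    have e1 : (u * (1 + 7 / 10 * h)) ^ 2 * (v * (1 - 13 / 10 * h)) ≤ _ :=
      mul_le_mul (pow_le_pow_left₀ (by positivity) eu 2) ev
        (mul_nonneg hv0.le (by linarith)) (sq_nonneg _)
    refine le_trans ?_ e1
    have e2 := one_le_sq_mul hh hh1
    have e3 : 0 ≤ u ^ 2 * v := by positivity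
    calc u ^ 2 * v = u ^ 2 * v * 1 := (mul_one _).symm
      _ ≤ u ^ 2 * v * ((1 + 7 / 10 * h) ^ 2 * (1 - 13 / 10 * h)) :=
        mul_le_mul_of_nonneg_left e2 e3
      _ = _ := by ring

/-- The region kept invariant by gradient descent on the reduced scalar dynamics. -/
structure GDInvariant (n : ℕ) (δ α β u₀ a p : ℝ) : Prop where
  diff_ge : -δ ≤ a - p
  diff_le : a - p ≤ 2
  upper : a ≤ 1 + 1 / (4 * (n : ℝ))
  lower : α ≤ a
  angle : a ≤ 5 * p ∨
    (5 * p < a ∧ a ^ n ≤ 21 / 100 ∧ u₀ ≤ a + p ∧ 144 / 125 * β ^ 3 ≤ (a + p) ^ 2 * (a - p))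

/-- Compatibility conditions between the constants of `GDInvariant` and the step size. -/
structure GDConstants (n : ℕ) (η δ α β u₀ : ℝ) : Prop where
  eta_nonneg : 0 ≤ η
  eta_small : η * n ≤ 1 / 2000
  delta_small : δ ≤ 1 / 1000
  delta_le : δ ≤ α
  delta_u : 100 * δ ≤ u₀
  delta_n : 12 * (n * δ) ≤ 1
  alpha_pos : 0 < α
  alpha_le : α ≤ (1 - 1 / (2 * (n : ℝ))) * β
  alpha_pow : α ^ n ≤ 3 / 20
  u_pos : 0 < u₀

theorem GDInvariant.bounds {m : ℕ} {η δ α β u₀ a p : ℝ} (hC : GDConstants (m + 2) η δ α β u₀)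
    (hI : GDInvariant (m + 2) δ α β u₀ a p) :
    0 < a ∧ a ≤ 9 / 8 ∧ 0 < a ^ m ∧ a ^ m ≤ 2 ∧ a ^ m * a ≤ 2 ∧ a ^ m * a ^ 2 ≤ 3 / 2 ∧
      1 ≤ ∑ i ∈ Finset.range (m + 2), a ^ i ∧
      ∑ i ∈ Finset.range (m + 2), a ^ i ≤ 2 * ((m + 2 : ℕ) : ℝ) ∧
      1 - a ^ m * a ^ 2 = (∑ i ∈ Finset.range (m + 2), a ^ i) * (1 - a) := by
  have hn : (2 : ℝ) ≤ ((m + 2 : ℕ) : ℝ) := by push_cast; linarith [Nat.cast_nonneg (α := ℝ) m]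
  have ha : 0 < a := hC.alpha_pos.trans_le hI.lower
  have hb : ∀ k ≤ m + 2, a ^ k ≤ 3 / 2 :=
    fun k hk => pow_le_three_halves (by omega) ha hI.upper hk
  have hw : 1 / (4 * ((m + 2 : ℕ) : ℝ)) ≤ 1 / 8 := by
    apply one_div_le_one_div_of_le <;> linarith
  refine ⟨ha, by linarith [hI.upper], pow_pos ha m, (hb m (by omega)).trans (by norm_num), ?_, ?_, ?_, ?_, ?_⟩
  · rw [← pow_succ]; exact (hb _ (by omega)).trans (by norm_num)
  · rw [← pow_add]
    exact hb _ le_rfl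
  · rw [Finset.sum_range_succ']
    have : 0 ≤ ∑ i ∈ Finset.range (m + 1), a ^ (i + 1) :=
      Finset.sum_nonneg fun i _ => by positivity
    simpa using this
  · calc ∑ i ∈ Finset.range (m + 2), a ^ i ≤ ∑ i ∈ Finset.range (m + 2), (2 : ℝ) :=
          Finset.sum_le_sum fun i hi =>
            (hb i (Finset.mem_range.1 hi).le).trans (by norm_num)
      _ = 2 * ((m + 2 : ℕ) : ℝ) := by simp [mul_comm]
  · rw [geom_sum_mul_neg, ← pow_add]

theorem GDInvariant.step {m : ℕ} {η δ α β u₀ a p D a' p' : ℝ}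
    (hC : GDConstants (m + 2) η δ α β u₀)
    (hI : GDInvariant (m + 2) δ α β u₀ a p) (hD : |D| ≤ δ)
    (ha' : a' = a - η * (a ^ m * (a ^ m * a * (a ^ 2 + D) - p)))
    (hp' : p' = p - η * (a ^ m * a * (a ^ m * a * p - 1))) :
    GDInvariant (m + 2) δ α β u₀ a' p' := by
  obtain ⟨ha, ha8, hc, hc2, hca, hB, hS1, hS2, hfac⟩ := hI.bounds hC
  have hpow : a ^ m * a ^ 2 = a ^ (m + 2) := (pow_add a m 2).symm
  have hη := hC.eta_nonneg
  have hηn := hC.eta_small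
  have hn : (2 : ℝ) ≤ ((m + 2 : ℕ) : ℝ) := by push_cast; linarith [Nat.cast_nonneg (α := ℝ) m]
  generalize hN : m + 2 = n at *
  set c := a ^ m with hcdef
  clear_value c
  set S := ∑ i ∈ Finset.range n, a ^ i
  clear_value S
  set h := η * c with hh
  have hh0 : 0 ≤ h := by positivity
  have hhn : h * n ≤ 1 / 1000 := by
    have : η * n * c ≤ 1 / 2000 * 2 := mul_le_mul hηn hc2 hc.le (by norm_num)
    rw [hh]; linarith
  have hh1 : h ≤ 1 / 1000 := by nlinarith
  have hhS : h * a * S ≤ 1 := by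
    have h1 : h * S ≤ h * (2 * n) := mul_le_mul_of_nonneg_left hS2 hh0
    nlinarith
  have hstep : h * (1 + c * a ^ 2) ≤ 1 := by nlinarith
  have hcpos : 0 ≤ c * a ^ 2 := by positivity
  have hbB : c * a ≤ 1 + c * a ^ 2 := by
    rcases le_total a 1 with h1 | h1
    · have hc1 : c ≤ 1 := hcdef ▸ pow_le_one₀ ha.le h1
      nlinarith
    · nlinarith
  have ea : a' = a + h * (p - a * (c * a ^ 2) - c * a * D) := by rw [ha', hh]; ring
  have ep : p' = p + h * (a - c * a ^ 2 * p) := by rw [hp', hh]; ring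
  have ea2 : a' = a + h * (a * (1 - c * a ^ 2) - (a - p) - c * a * D) := by rw [ea]; ring
  have ev : a' - p' = (a - p) - h * ((1 + c * a ^ 2) * (a - p) + c * a * D) := by
    rw [ea, ep]; ring
  have eu : a' + p' = (a + p) + h * ((1 - c * a ^ 2) * (a + p) - c * a * D) := by
    rw [ea, ep]; ring
  obtain ⟨hv1, hv2⟩ := diff_step hh0 hcpos (by positivity) hbB hstep hD
    (hC.delta_small.trans (by norm_num)) hI.diff_ge hI.diff_le
  rw [← ev] at hv1 hv2
  have hup : a' ≤ 1 + 1 / (4 * (n : ℝ)) := by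
    rw [ea2]
    refine upper_step ha hI.upper hca hc.le hh0 (by linarith) hS1 hhS hfac hD hI.diff_ge ?_
    rw [le_div_iff₀ (by linarith)]
    linarith [hC.delta_n]
  have key : α ≤ a' ∧ (a' ≤ 5 * p' ∨
    (5 * p' < a' ∧ a' ^ n ≤ 21 / 100 ∧ u₀ ≤ a' + p' ∧
      144 / 125 * β ^ 3 ≤ (a' + p') ^ 2 * (a' - p'))) := by
    rcases hI.angle with h5 | ⟨h5, hlow, hu, hF⟩
    · obtain ⟨r1, r2⟩ := aligned_step hC.alpha_pos hI.lower hc.le hc2 hpow (hpow ▸ hB) hh0 hhn hh1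
        hD hC.delta_small hC.delta_le hI.diff_ge h5 hC.alpha_pow
      rw [← ea] at r1 r2
      rw [← ep] at r2
      exact ⟨r1, Or.inl r2⟩
    · have ha1 : a ≤ 1 := by
        by_contra! h1
        linarith [one_le_pow₀ h1.le (n := n)]
      have hc1 : c ≤ 1 := hcdef ▸ pow_le_one₀ ha.le ha1
      obtain ⟨r1, r2, r3, r4⟩ := unaligned_step ha ha1 hc.le hc1 hpow hlow hh0 hhn hh1 hD
        hC.delta_small hC.delta_u hC.u_pos hu h5 hF
      rw [← ea] at r1 r2
      rw [← eu] at r3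
      rw [← eu, ← ev] at r4
      refine ⟨?_, ?_⟩
      · have hβ : β ≤ a := by
          have := sq_mul_le_cube (hC.u_pos.le.trans hu) h5.le
          exact le_of_pow_le_pow_left₀ (n := 3) (by norm_num) ha.le (by linarith)
        have e1 : 2 * h ≤ 1 / (2 * (n : ℝ)) := by
          rw [le_div_iff₀ (by linarith)]; linarith
        have e2 : 1 / (2 * (n : ℝ)) ≤ 1 := by
          rw [div_le_one (by linarith)]; linarith
        calc α ≤ (1 - 1 / (2 * (n : ℝ))) * β := hC.alpha_le
          _ ≤ (1 - 1 / (2 * (n : ℝ))) * a := mul_le_mul_of_nonneg_left hβ (by linarith)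
          _ ≤ (1 - 2 * h) * a := mul_le_mul_of_nonneg_right (by linarith) ha.le
          _ ≤ a' := by linarith
      · rcases le_or_gt a' (5 * p') with h6 | h6
        · exact Or.inl h6
        · exact Or.inr ⟨h6, r2, r3, r4⟩
  exact ⟨hv1, hv2, hup, key.1, key.2⟩

theorem gd_potential_le {m : ℕ} {η δ α β u₀ : ℝ} {a p D : ℕ → ℝ} {K : ℕ}
    (hC : GDConstants (m + 2) η δ α β u₀) (hK : 400 * η ^ 2 * K ≤ δ)
    (h0 : GDInvariant (m + 2) δ α β u₀ (a 0) (p 0)) (hD0 : D 0 = 0)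
    (ha : ∀ k, a (k + 1) =
      a k - η * (a k ^ m * (a k ^ m * a k * (a k ^ 2 + D k) - p k)))
    (hp : ∀ k, p (k + 1) = p k - η * (a k ^ m * a k * (a k ^ m * a k * p k - 1)))
    (hD : ∀ k, D (k + 1) = D k + η ^ 2 *
      ((a k ^ m * a k) ^ 2 *
          ((a k ^ m * a k) ^ 2 * (a k ^ 2 + D k) - 2 * (a k ^ m * a k) * p k + 1) -
        (a k ^ m * (a k ^ m * a k * (a k ^ 2 + D k) - p k)) ^ 2))
    {k : ℕ} (hk : k ≤ K) :
    GDInvariant (m + 2) δ α β u₀ (a k) (p k) ∧ |D k| ≤ 400 * η ^ 2 * k ∧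
      |1 - a k| + 4 * |a k - p k| ≤ 20 * δ + 9 * (1 - η * α ^ (m + 2) / 2) ^ k := by
  have hη := hC.eta_nonneg
  induction k with
  | zero =>
    obtain ⟨ha0, ha8, -⟩ := h0.bounds hC
    refine ⟨h0, by simp [hD0], ?_⟩
    have e1 : |1 - a 0| ≤ 1 := abs_le.2 ⟨by linarith, by linarith⟩
    have hδ0 : 0 ≤ δ := le_trans (by positivity) hK
    have e2 : |a 0 - p 0| ≤ 2 :=
      abs_le.2 ⟨by linarith [h0.diff_ge, hC.delta_small], h0.diff_le⟩
    simp only [pow_zero]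
    linarith
  | succ k ih =>
    obtain ⟨hI, hDk, hG⟩ := ih (by omega)
    have hDδ : |D k| ≤ δ := by
      refine hDk.trans (le_trans ?_ hK)
      have : (k : ℝ) ≤ K := by exact_mod_cast (by omega : k ≤ K)
      gcongr
    obtain ⟨ha0, ha8, hc, hc2, hca, hB, hS1, hS2, hfac⟩ := hI.bounds hC
    have hI' := hI.step hC hDδ (ha k) (hp k)
    have hηn := hC.eta_small
    have hn : (2 : ℝ) ≤ ((m + 2 : ℕ) : ℝ) := by push_cast; linarith [Nat.cast_nonneg (α := ℝ) m]
    refine ⟨hI', ?_, ?_⟩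
    · have := abs_balance_drift_le ha0 (by linarith) hc hc2 hca hI.diff_ge hI.diff_le hDδ
        hC.delta_small
      rw [hD k]
      refine (abs_add_le _ _).trans ?_
      rw [abs_mul, abs_of_nonneg (sq_nonneg η)]
      push_cast
      linarith [mul_le_mul_of_nonneg_left this (sq_nonneg η)]
    · have hα : α ^ (m + 2) ≤ a k ^ m * a k := by
        calc α ^ (m + 2) ≤ α ^ (m + 1) := by
              refine pow_le_pow_of_le_one hC.alpha_pos.le ?_ (by omega)
              by_contra! h1
              linarith [one_le_pow₀ h1.le (n := m + 2), hC.alpha_pow]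
          _ ≤ a k ^ (m + 1) := pow_le_pow_left₀ hC.alpha_pos.le hI.lower _
          _ = _ := pow_succ _ _
      have hh0 : 0 ≤ η * a k ^ m := by positivity
      have hh2 : η * a k ^ m ≤ η * 2 := mul_le_mul_of_nonneg_left hc2 hη
      have hη2 : η ≤ 1 / 4000 := by nlinarith
      have hhS : η * a k ^ m * a k * ∑ i ∈ Finset.range (m + 2), a k ^ i ≤ 1 := by
        have h1 : η * a k ^ m * a k ≤ η * 2 * (9 / 8) := mul_le_mul hh2 ha8 ha0.le (by positivity)
        have h2 := mul_le_mul h1 hS2 (by linarith) (by positivity)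
        linarith
      have hst := potential_step ha0 (by linarith) hc.le hc2 hh0 hS1 hhS (by nlinarith) hfac hDδ
        (v := a k - p k)
      have ea : a (k + 1) = a k + η * a k ^ m *
          (a k * (1 - a k ^ m * a k ^ 2) - (a k - p k) - a k ^ m * a k * D k) := by
        rw [ha k]; ring
      have ev : a (k + 1) - p (k + 1) = (a k - p k) - η * a k ^ m *
          ((1 + a k ^ m * a k ^ 2) * (a k - p k) + a k ^ m * a k * D k) := by
        rw [ha k, hp k]; ring
      rw [← ea, ← ev] at hst
      refine hst.trans ?_
      have hfac1 : 0 ≤ 1 - η * a k ^ m * a k / 2 := by nlinarith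
      have hfac2 : 1 - η * a k ^ m * a k / 2 ≤ 1 - η * α ^ (m + 2) / 2 := by
        linarith [mul_le_mul_of_nonneg_left hα hη]
      have hpow : 0 ≤ 9 * (1 - η * α ^ (m + 2) / 2) ^ k := by
        have := hfac1.trans hfac2
        positivity
      have e1 := mul_le_mul_of_nonneg_left (by linarith : |1 - a k| + 4 * |a k - p k| - 20 * δ ≤
        9 * (1 - η * α ^ (m + 2) / 2) ^ k) hfac1
      have e2 := mul_le_mul_of_nonneg_right hfac2 hpow
      rw [pow_succ]
      linarith

theorem GDInvariant.loss_le {m : ℕ} {η δ α β u₀ a p D X ε : ℝ}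
    (hC : GDConstants (m + 2) η δ α β u₀) (hI : GDInvariant (m + 2) δ α β u₀ a p)
    (hD : |D| ≤ δ) (hδ : 1000 * δ ≤ ε) (hε : ε ≤ 1) (hX : |1 - a| + 4 * |a - p| ≤ X)
    (hXε : 7 * (((m + 2 : ℕ) : ℝ) * X) ≤ ε) :
    1 / 2 * ((a ^ m * a) ^ 2 * (a ^ 2 + D) - 2 * (a ^ m * a) * p + 1) ≤ ε := by
  obtain ⟨ha, ha8, hc, hc2, hca, hB, hS1, hS2, hfac⟩ := hI.bounds hC
  have hn : (2 : ℝ) ≤ ((m + 2 : ℕ) : ℝ) := by push_cast; linarith [Nat.cast_nonneg (α := ℝ) m]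
  have hX0 : 0 ≤ X := le_trans (by positivity) hX
  have hδ0 : 0 ≤ δ := (abs_nonneg D).trans hD
  have hX2 : 14 * X ≤ ε := by nlinarith
  have hca0 : 0 < a ^ m * a := by positivity
  have e1 : |1 - a ^ m * a ^ 2| ≤ 2 / 7 * ε := by
    rw [hfac, abs_mul, abs_of_nonneg (by linarith)]
    have : |1 - a| ≤ X := by linarith [abs_nonneg (a - p)]
    have := mul_le_mul hS2 this (abs_nonneg _) (by positivity)
    linarith
  have e2 : (1 - a ^ m * a ^ 2) ^ 2 ≤ (2 / 7) ^ 2 * ε := by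
    rw [← sq_abs]
    nlinarith [abs_nonneg (1 - a ^ m * a ^ 2)]
  have e3 : a ^ m * a * (a - p) ≤ ε / 28 := by
    have h1 : a - p ≤ X / 4 := by linarith [abs_nonneg (1 - a), le_abs_self (a - p)]
    nlinarith
  have e4 : (a ^ m * a) ^ 2 * D ≤ 4 * δ := by
    have : (a ^ m * a) ^ 2 ≤ 4 := by nlinarith
    nlinarith [le_abs_self D, sq_nonneg (a ^ m * a)]
  have : (a ^ m * a) ^ 2 * (a ^ 2 + D) - 2 * (a ^ m * a) * p + 1 =
      (1 - a ^ m * a ^ 2) ^ 2 + 2 * (a ^ m * a * (a - p)) + (a ^ m * a) ^ 2 * D := by ring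
  rw [this]
  linarith

theorem denominator_ge {n : ℕ} (hn : 2 ≤ n) {R M : ℝ} (hM : M = max 1 R) :
    5 * 10 ^ 7 * (n : ℝ) ^ 2 * (max 1 (3 / 2 * R)) ^ n * M ≤
      (n : ℝ) ^ ((17 : ℝ) / 2) * Real.exp (7 * (n : ℝ) + 6) * M ^ ((11 * (n : ℝ) - 5) / 2) := by
  have hn2 : (2 : ℝ) ≤ n := by exact_mod_cast hn
  have hM1 : 1 ≤ M := hM ▸ le_max_left _ _
  have e1 : (n : ℝ) ^ 2 ≤ (n : ℝ) ^ ((17 : ℝ) / 2) := by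
    rw [← Real.rpow_natCast]
    exact Real.rpow_le_rpow_of_exponent_le (by linarith) (by norm_num)
  have e2 : M ^ n * M ≤ M ^ ((11 * (n : ℝ) - 5) / 2) := by
    rw [← pow_succ, ← Real.rpow_natCast]
    refine Real.rpow_le_rpow_of_exponent_le hM1 ?_
    push_cast
    linarith
  have e27 := Real.exp_one_gt_d9
  have e3 : (3 / 2 : ℝ) ^ n * (5 * 10 ^ 7) ≤ Real.exp (7 * (n : ℝ) + 6) := by
    have h1 : (3 / 2 : ℝ) ^ n ≤ Real.exp n := by
      rw [← Real.exp_one_pow]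
      exact pow_le_pow_left₀ (by norm_num) (by linarith) n
    have h2 : (5 * 10 ^ 7 : ℝ) ≤ Real.exp 18 := by
      have : Real.exp 18 = Real.exp 1 ^ 18 := by
        rw [Real.exp_one_pow]; norm_num
      rw [this]
      calc (5 * 10 ^ 7 : ℝ) ≤ 2.7 ^ 18 := by norm_num
        _ ≤ _ := pow_le_pow_left₀ (by norm_num) (by linarith) 18
    calc (3 / 2 : ℝ) ^ n * (5 * 10 ^ 7) ≤ Real.exp n * Real.exp 18 :=
          mul_le_mul h1 h2 (by norm_num) (by positivity)
      _ = Real.exp (n + 18) := (Real.exp_add _ _).symm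
      _ ≤ _ := Real.exp_le_exp.2 (by linarith)
  have e4 : (max 1 (3 / 2 * R)) ^ n ≤ (3 / 2) ^ n * M ^ n := by
    rw [← mul_pow]
    refine pow_le_pow_left₀ (by positivity) (max_le (by linarith) ?_) n
    have : R ≤ M := hM ▸ le_max_right _ _
    linarith
  calc 5 * 10 ^ 7 * (n : ℝ) ^ 2 * (max 1 (3 / 2 * R)) ^ n * M
      ≤ 5 * 10 ^ 7 * (n : ℝ) ^ 2 * ((3 / 2) ^ n * M ^ n) * M := by gcongr
    _ = (n : ℝ) ^ 2 * ((3 / 2 : ℝ) ^ n * (5 * 10 ^ 7)) * (M ^ n * M) := by ring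
    _ ≤ _ := by gcongr

/-- The hypothesis on the step size, freed from its real powers and exponentials. -/
theorem step_size_bounds {N b M L s ε η : ℝ} (hN : 2 ≤ N) (hb : 1 ≤ b) (hM : 1 ≤ M) (hL : 1 ≤ L)
    (hs : 0 < s) (hs1 : s ≤ 1 / 5) (hε : 0 < ε) (hε1 : ε ≤ 1) (hη : 0 < η)
    (h : η * (5 * 10 ^ 7 * N ^ 2 * b * M * L ^ 2) ≤ s ^ 5 * ε) :
    η * N ≤ 1 / 2000 ∧
      400 * η ^ 2 * (2 * N * b / (s * η) * L + 1) ≤ 1 / 10000 * (ε * s / (N * M)) := by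
  have hs5 : s ^ 5 ≤ s ^ 2 := pow_le_pow_of_le_one hs.le (by linarith) (by norm_num)
  have hbML : 1 ≤ b * M * L ^ 2 := by
    have : 1 ≤ L ^ 2 := one_le_pow₀ hL
    have h2 : 1 ≤ b * M := one_le_mul_of_one_le_of_one_le hb hM
    exact one_le_mul_of_one_le_of_one_le h2 this
  have h0 : η * (5 * 10 ^ 7 * N ^ 2 * b * M * L ^ 2) ≤ s ^ 2 * ε :=
    h.trans (mul_le_mul_of_nonneg_right hs5 hε.le)
  have hηN2 : η * N ^ 2 * (5 * 10 ^ 7) ≤ s ^ 2 * ε := by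
    refine le_trans ?_ h0
    have : 0 ≤ η * N ^ 2 * (5 * 10 ^ 7) := by positivity
    nlinarith
  have hsε : s ^ 2 * ε ≤ s * ε := by
    have : s ^ 2 ≤ s := by nlinarith
    exact mul_le_mul_of_nonneg_right this hε.le
  have hsε1 : s * ε ≤ 1 := by nlinarith
  have hηN : η * N * 2 ≤ η * N ^ 2 := by nlinarith [mul_pos hη (by linarith : 0 < N)]
  have hηN0 : 0 < η * N := by positivity
  refine ⟨by linarith, ?_⟩
  rw [mul_div_assoc', le_div_iff₀ (by positivity)]
  have e1 : 400 * η ^ 2 * (2 * N * b / (s * η) * L + 1) * (N * M) =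
      (800 * (η * N ^ 2 * b * M * L)) / s + 400 * η * (η * N * M) := by
    field_simp; ring
  rw [e1]
  have hML : M ≤ b * M * L ^ 2 := by
    have : 1 ≤ L ^ 2 := one_le_pow₀ hL
    have h2 : M ≤ b * M := le_mul_of_one_le_left (by linarith) hb
    exact h2.trans (le_mul_of_one_le_right (by positivity) this)
  have e2 : η * N ^ 2 * b * M * L * (5 * 10 ^ 7) ≤ s ^ 2 * ε := by
    refine le_trans ?_ h0
    have hLL : L ≤ L ^ 2 := by nlinarith
    have : 0 ≤ η * N ^ 2 * b * M * (5 * 10 ^ 7) := by positivity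
    nlinarith
  have e3 : (800 * (η * N ^ 2 * b * M * L)) / s ≤ 2 / 10 ^ 5 * (s * ε) := by
    rw [div_le_iff₀ hs]
    have : s ^ 2 * ε = s * ε * s := by ring
    rw [this] at e2
    have : 0 ≤ s * ε * s := by positivity
    linarith
  have e4 : 400 * η * (η * N * M) ≤ 1 / 10 ^ 5 * (s * ε) := by
    have h1 : η * N * M * (5 * 10 ^ 7) ≤ s * ε := by
      refine le_trans ?_ (h0.trans hsε)
      have h2 : η * N ≤ η * N ^ 2 := by linarith
      calc η * N * M * (5 * 10 ^ 7) ≤ η * N ^ 2 * (b * M * L ^ 2) * (5 * 10 ^ 7) := by gcongr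
        _ = _ := by ring
    have h3 : η ≤ 1 := by nlinarith
    have h4 : 0 ≤ η * N * M := by positivity
    have : 400 * η * (η * N * M) ≤ 400 * (η * N * M) := by nlinarith
    have : 0 < s * ε := by positivity
    linarith
  have : 0 < s * ε := by positivity
  linarith

theorem one_sub_inv_pow_bounds {n : ℕ} (hn : 0 < n) :
    1 / 2 ≤ (1 - 1 / (2 * (n : ℝ))) ^ n ∧ (1 - 1 / (2 * (n : ℝ))) ^ n ≤ 2 / 3 := by
  have hn1 : (1 : ℝ) ≤ n := by exact_mod_cast hn
  have hinv : 1 / (2 * (n : ℝ)) ≤ 1 := by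
    rw [div_le_one (by linarith)]; linarith
  have hinv0 : 0 < 1 / (2 * (n : ℝ)) := by positivity
  have hge : 1 / 2 ≤ (1 - 1 / (2 * (n : ℝ))) ^ n := by
    have := one_add_mul_le_pow (a := -(1 / (2 * (n : ℝ)))) (by linarith) n
    have e : 1 + (n : ℝ) * -(1 / (2 * (n : ℝ))) = 1 / 2 := by
      field_simp; norm_num
    rw [e] at this
    rwa [sub_eq_add_neg]
  refine ⟨hge, ?_⟩
  have h1 := one_add_mul_le_pow (a := 1 / (2 * (n : ℝ))) (by linarith) n
  have e : 1 + (n : ℝ) * (1 / (2 * (n : ℝ))) = 3 / 2 := by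
    field_simp; norm_num
  rw [e] at h1
  have h2 : (1 - 1 / (2 * (n : ℝ))) ^ n * (1 + 1 / (2 * (n : ℝ))) ^ n ≤ 1 := by
    rw [← mul_pow]
    refine pow_le_one₀ (mul_nonneg (by linarith) (by linarith)) ?_
    linarith [mul_self_nonneg (1 / (2 * (n : ℝ)))]
  nlinarith

theorem cube_le_sq_mul {a₀ ν β : ℝ} (ha₀ : 0 < a₀) (h5 : ν ≤ 1 / 5)
    (hβ : β * (1 - ν) = 2 / 3 * (1 + ν) * a₀) :
    144 / 125 * β ^ 3 ≤ (a₀ + ν * a₀) ^ 2 * (a₀ - ν * a₀) := by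
  have h1ν : 0 < 1 - ν := by linarith
  have hβe : β = 2 / 3 * (1 + ν) * a₀ / (1 - ν) := by
    rw [eq_div_iff h1ν.ne']; exact hβ
  have hfour : (4 / 5 : ℝ) ^ 4 ≤ (1 - ν) ^ 4 :=
    pow_le_pow_left₀ (by norm_num) (by linarith) 4
  rw [hβe, div_pow, mul_div_assoc', div_le_iff₀ (by positivity)]
  have e : (a₀ + ν * a₀) ^ 2 * (a₀ - ν * a₀) * (1 - ν) ^ 3 =
      (1 + ν) ^ 2 * a₀ ^ 3 * (1 - ν) ^ 4 := by ring
  have e' : 144 / 125 * (2 / 3 * (1 + ν) * a₀) ^ 3 =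
      (1 + ν) ^ 2 * a₀ ^ 3 * (128 / 375 * (1 + ν)) := by ring
  rw [e, e']
  refine mul_le_mul_of_nonneg_left ?_ (by positivity)
  linarith

set_option maxHeartbeats 1000000 in
theorem gd_constants {m : ℕ} {η a₀ ν R M s ε : ℝ} (ha₀ : 0 < a₀) (hs : a₀ ^ (m + 2) = s)
    (hs1 : s ≤ 1 / 5) (hν : -1 < ν) (hν1 : ν ≤ 1) (hR : R = (1 - ν) / (1 + ν)) (hM : M = max 1 R)
    (hε : 0 < ε) (hε1 : ε ≤ 1) (hη : 0 < η) (hηn : η * ((m + 2 : ℕ) : ℝ) ≤ 1 / 2000) :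
    let N : ℝ := ((m + 2 : ℕ) : ℝ)
    let β := a₀ / max 1 (3 / 2 * R)
    let δ := 1 / 10000 * (ε * s / (N * M))
    let α := (1 - 1 / (2 * N)) * β
    GDConstants (m + 2) η δ α β ((1 + ν) * a₀) ∧
      GDInvariant (m + 2) δ α β ((1 + ν) * a₀) a₀ (ν * a₀) ∧
      s / (max 1 (3 / 2 * R)) ^ (m + 2) ≤ 2 * α ^ (m + 2) := by
  intro N β δ α
  have hN : (2 : ℝ) ≤ N := by
    simp only [N]; push_cast; linarith [Nat.cast_nonneg (α := ℝ) m]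
  have hR0 : 0 ≤ R := hR ▸ div_nonneg (by linarith) (by linarith)
  have hM1 : 1 ≤ M := hM ▸ le_max_left _ _
  have hRM : R ≤ M := hM ▸ le_max_right _ _
  have hs0 : 0 < s := hs ▸ pow_pos ha₀ _
  have ha1 : a₀ ≤ 1 := by
    by_contra! h1
    linarith [one_le_pow₀ h1.le (n := m + 2)]
  have hsa : s ≤ a₀ := by
    rw [← hs]
    simpa using pow_le_pow_of_le_one ha₀.le ha1 (show 1 ≤ m + 2 by omega)
  set b := max 1 (3 / 2 * R) with hb
  have hb1 : 1 ≤ b := le_max_left _ _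
  have hbM : b ≤ 3 / 2 * M := max_le (by linarith) (by linarith)
  have hb0 : 0 < b := by linarith
  have hβ0 : 0 < β := div_pos ha₀ hb0
  have hβb : β * b = a₀ := div_mul_cancel₀ _ hb0.ne'
  have hβa : β ≤ a₀ := div_le_self ha₀.le hb1
  have hinv : 1 / (2 * N) ≤ 1 / 4 := by
    apply one_div_le_one_div_of_le <;> linarith
  have hinv0 : 0 < 1 / (2 * N) := by positivity
  have hδM : δ * (N * M) = 1 / 10000 * (ε * s) := by
    simp only [δ]; field_simp
  have hδ0 : 0 < δ := by positivity
  have hεs : ε * s ≤ s := by nlinarith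
  have hδNM : δ * M ≤ s / 10000 := by
    have : δ * M * 1 ≤ δ * M * N := mul_le_mul_of_nonneg_left (by linarith) (by positivity)
    linarith
  have hδN : δ * N ≤ s / 10000 := by
    have : δ * N * 1 ≤ δ * N * M := mul_le_mul_of_nonneg_left (by linarith) (by positivity)
    linarith
  have hδs : δ ≤ s / 10000 := by nlinarith
  have hα34 : 3 / 4 * β ≤ α := mul_le_mul_of_nonneg_right (by linarith) hβ0.le
  have hαa : α ≤ a₀ := by
    have : α ≤ 1 * β := mul_le_mul_of_nonneg_right (by linarith) hβ0.le
    linarith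
  obtain ⟨hpowge, hpowle⟩ := one_sub_inv_pow_bounds (n := m + 2) (by omega)
  have hβpow : β ^ (m + 2) ≤ s := hs ▸ pow_le_pow_left₀ hβ0.le hβa _
  have hβpow0 : 0 < β ^ (m + 2) := pow_pos hβ0 _
  have hαpow : α ^ (m + 2) = (1 - 1 / (2 * N)) ^ (m + 2) * β ^ (m + 2) := mul_pow _ _ _
  have hνR : (1 + ν) * R = 1 - ν := by
    rw [hR, mul_div_cancel₀ _ (by linarith : 1 + ν ≠ 0)]
  have hu : a₀ ≤ (1 + ν) * a₀ * M := by
    have h1 := mul_le_mul_of_nonneg_left hRM (by linarith : 0 ≤ 1 + ν)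
    have h2 := mul_le_mul_of_nonneg_left hM1 (by linarith : 0 ≤ 1 + ν)
    have : 1 ≤ (1 + ν) * M := by linarith
    calc a₀ = a₀ * 1 := (mul_one _).symm
      _ ≤ a₀ * ((1 + ν) * M) := mul_le_mul_of_nonneg_left this ha₀.le
      _ = _ := by ring
  refine ⟨⟨hη.le, hηn, by linarith, ?_, ?_, ?_, by linarith, le_rfl, ?_, ?_⟩,
    ⟨?_, ?_, ?_, hαa, ?_⟩, ?_⟩
  · have : δ * M ≤ 3 / 4 * β * M := by nlinarith
    exact (le_of_mul_le_mul_right this (by linarith)).trans hα34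
  · have : 100 * δ * M ≤ (1 + ν) * a₀ * M := by linarith
    exact le_of_mul_le_mul_right this (by linarith)
  · change 12 * (N * δ) ≤ 1
    linarith
  · rw [hαpow]; nlinarith
  · exact mul_pos (by linarith) ha₀
  · nlinarith
  · nlinarith
  · have : 0 ≤ 1 / (4 * N) := by positivity
    change a₀ ≤ 1 + 1 / (4 * N)
    linarith
  · rcases le_or_gt (1 / 5) ν with h5 | h5
    · left; nlinarith
    · right
      refine ⟨by nlinarith, by linarith, by linarith, ?_⟩
      have hR23 : 2 / 3 ≤ R := by
        rw [hR, le_div_iff₀ (by linarith)]; linarith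
      have hbR : b = 3 / 2 * R := max_eq_right (by linarith)
      have hβR : β * (1 - ν) = 2 / 3 * (1 + ν) * a₀ := by
        rw [← hβb, hbR, ← hνR]; ring
      exact cube_le_sq_mul ha₀ h5.le hβR
  · have : s / b ^ (m + 2) = β ^ (m + 2) := by rw [← hs, ← div_pow]
    rw [this, hαpow]
    nlinarith

set_option maxHeartbeats 1000000 in
/-- Convergence of the scalar dynamics to which gradient descent reduces. -/
theorem scalar_gd_loss_le {m : ℕ} {a p D : ℕ → ℝ} {η ν s ε : ℝ}
    (ha0 : 0 < a 0) (hs : a 0 ^ (m + 2) = s) (hs1 : s ≤ 1 / 5) (hp0 : p 0 = ν * a 0)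
    (hD0 : D 0 = 0) (hν : -1 < ν) (hν1 : ν ≤ 1) (hε : 0 < ε) (hε1 : ε ≤ 1) (hη : 0 < η)
    (ha : ∀ k, a (k + 1) =
      a k - η * (a k ^ m * (a k ^ m * a k * (a k ^ 2 + D k) - p k)))
    (hp : ∀ k, p (k + 1) = p k - η * (a k ^ m * a k * (a k ^ m * a k * p k - 1)))
    (hD : ∀ k, D (k + 1) = D k + η ^ 2 *
      ((a k ^ m * a k) ^ 2 *
          ((a k ^ m * a k) ^ 2 * (a k ^ 2 + D k) - 2 * (a k ^ m * a k) * p k + 1) -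
        (a k ^ m * (a k ^ m * a k * (a k ^ 2 + D k) - p k)) ^ 2))
    {n : ℕ} (hn : n = m + 2) {R M L : ℝ} (hR : R = (1 - ν) / (1 + ν)) (hM : M = max 1 R)
    (hL : L = Real.log (15 * (n : ℝ) * M / (s * ε)))
    (hηle : η ≤ s ^ 5 * ε / ((n : ℝ) ^ ((17 : ℝ) / 2) * Real.exp (7 * (n : ℝ) + 6) *
      M ^ ((11 * (n : ℝ) - 5) / 2)) / L ^ 2)
    {K : ℕ} (hK : K = ⌊2 * (n : ℝ) * (max 1 (3 / 2 * R)) ^ n / (s * η) * L + 1⌋₊) :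
    1 / 2 * ((a K ^ m * a K) ^ 2 * (a K ^ 2 + D K) - 2 * (a K ^ m * a K) * p K + 1) ≤ ε := by
  subst hn
  have hs0 : 0 < s := hs ▸ pow_pos ha0 _
  have hR0 : 0 ≤ R := hR ▸ div_nonneg (by linarith) (by linarith)
  have hM1 : 1 ≤ M := hM ▸ le_max_left _ _
  have hden := denominator_ge (n := m + 2) (by omega) hM
  have hN : (2 : ℝ) ≤ ((m + 2 : ℕ) : ℝ) := by push_cast; linarith [Nat.cast_nonneg (α := ℝ) m]
  set N : ℝ := ((m + 2 : ℕ) : ℝ) with hNdef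
  set b := (max 1 (3 / 2 * R)) ^ (m + 2) with hb
  have hb1 : 1 ≤ b := one_le_pow₀ (le_max_left _ _)
  have hsε : 0 < s * ε := by positivity
  have hsε1 : s * ε ≤ 1 / 5 := by nlinarith
  have hNM : 2 ≤ N * M := by nlinarith
  have hexpL : Real.exp L = 15 * N * M / (s * ε) := by
    rw [hL, Real.exp_log (by positivity)]
  have hL1 : 1 ≤ L := by
    rw [← Real.exp_le_exp, hexpL, le_div_iff₀ hsε]
    nlinarith [Real.exp_one_lt_d9, Real.exp_pos 1]
  have hηle' : η * (5 * 10 ^ 7 * N ^ 2 * b * M * L ^ 2) ≤ s ^ 5 * ε := by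
    have hpos : 0 < N ^ ((17 : ℝ) / 2) * Real.exp (7 * N + 6) * M ^ ((11 * N - 5) / 2) := by
      positivity
    rw [le_div_iff₀ (by positivity), le_div_iff₀ hpos] at hηle
    refine le_trans ?_ hηle
    calc η * (5 * 10 ^ 7 * N ^ 2 * b * M * L ^ 2) = η * L ^ 2 * (5 * 10 ^ 7 * N ^ 2 * b * M) := by
          ring
      _ ≤ _ := mul_le_mul_of_nonneg_left hden (by positivity)
  obtain ⟨hηN, hδ⟩ := step_size_bounds hN hb1 hM1 hL1 hs0 hs1 hε hε1 hη hηle'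
  obtain ⟨hC, hI, hα⟩ := gd_constants ha0 hs hs1 hν hν1 hR hM hε hε1 hη hηN
  rw [← hp0] at hI
  rw [← hNdef, ← hb] at *
  set δ := 1 / 10000 * (ε * s / (N * M)) with hδdef
  set α := (1 - 1 / (2 * N)) * (a 0 / max 1 (3 / 2 * R)) with hαdef
  set T := 2 * N * b / (s * η) * L with hT
  have hT0 : 0 ≤ T := by positivity
  have hKle : (K : ℝ) ≤ T + 1 := hK ▸ Nat.floor_le (by positivity)
  have hKge : T ≤ K := by
    have := Nat.lt_floor_add_one (T + 1)
    rw [← hK] at this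
    linarith
  have hKδ : 400 * η ^ 2 * K ≤ δ := le_trans (by gcongr) hδ
  obtain ⟨hIK, hDK, hGK⟩ := gd_potential_le hC hKδ hI hD0 ha hp hD (le_refl K)
  have hNδ : N * δ ≤ ε / 10000 := by
    have : N * δ = 1 / 10000 * (ε * s / M) := by rw [hδdef]; field_simp
    rw [this]
    have : ε * s / M ≤ ε := by
      rw [div_le_iff₀ (by linarith)]
      nlinarith
    linarith
  have hδ0 : 0 ≤ δ := le_trans (by positivity) hKδ
  have hdecay : (1 - η * α ^ (m + 2) / 2) ^ K ≤ s * ε / (15 * N * M) := by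
    have hα1 : 0 < α ^ (m + 2) := pow_pos hC.alpha_pos _
    have h1 : 1 - η * α ^ (m + 2) / 2 ≤ Real.exp (-(η * α ^ (m + 2) / 2)) := by
      linarith [Real.add_one_le_exp (-(η * α ^ (m + 2) / 2))]
    have h2 : 0 ≤ 1 - η * α ^ (m + 2) / 2 := by
      have := hC.alpha_pow
      nlinarith
    have h3 : L ≤ K * (η * α ^ (m + 2) / 2) := by
      have : s ≤ 2 * α ^ (m + 2) * b := by
        rwa [div_le_iff₀ (by positivity)] at hα
      calc L ≤ N * L / 2 := by nlinarith
        _ = T * (η * (s / (2 * b)) / 2) := by rw [hT]; field_simp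
        _ ≤ K * (η * α ^ (m + 2) / 2) := by
          have : s / (2 * b) ≤ α ^ (m + 2) := by
            rw [div_le_iff₀ (by positivity)]; linarith
          gcongr
    calc (1 - η * α ^ (m + 2) / 2) ^ K ≤ Real.exp (-(η * α ^ (m + 2) / 2)) ^ K :=
          pow_le_pow_left₀ h2 h1 K
      _ = Real.exp (-(K * (η * α ^ (m + 2) / 2))) := by
          rw [← Real.exp_nat_mul]; congr 1; ring
      _ ≤ Real.exp (-L) := Real.exp_le_exp.2 (by linarith)
      _ = s * ε / (15 * N * M) := by rw [Real.exp_neg, hexpL, inv_div]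
  have hNdecay : N * (s * ε / (15 * N * M)) ≤ ε / 75 := by
    have : N * (s * ε / (15 * N * M)) = s * ε / (15 * M) := by field_simp
    rw [this, div_le_iff₀ (by positivity)]
    nlinarith
  have hN0 : (0 : ℝ) ≤ N := by linarith
  refine hIK.loss_le hC (hDK.trans hKδ) (by nlinarith) hε1 hGK ?_
  change 7 * (N * (20 * δ + 9 * (1 - η * α ^ (m + 2) / 2) ^ K)) ≤ ε
  have := mul_le_mul_of_nonneg_left hdecay hN0
  linarith

theorem castId_self (p : ℕ) : castId p p = 1 := by
  ext i j
  simp [castId, Matrix.one_apply, Fin.ext_iff]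

theorem segProd_succ {n : ℕ} (dims : ℕ → ℕ) (W : WeightFam n dims) {b : ℕ} (hb : b < n) :
    segProd dims W 0 (b + 1) = W ⟨b, hb⟩ * segProd dims W 0 b := by
  simp [segProd, hb]

theorem segProd_one {n : ℕ} (dims : ℕ → ℕ) (W : WeightFam n dims) (hn : 0 < n) :
    segProd dims W 0 1 = W ⟨0, hn⟩ := by
  rw [segProd_succ dims W hn]
  simp [segProd, castId_self]

theorem segProd_eq_zero_of_layer_eq_zero {n : ℕ} {dims : ℕ → ℕ} {W : WeightFam n dims}
    {j : ℕ} (hjn : j < n) (hj : W ⟨j, hjn⟩ = 0) {b : ℕ} (hjb : j < b) (hbn : b ≤ n) :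
    segProd dims W 0 b = 0 := by
  induction b, hjb using Nat.le_induction with
  | base => rw [segProd_succ dims W hjn, hj, Matrix.zero_mul]
  | succ b hb ih => rw [segProd_succ dims W (by omega), ih (by omega), Matrix.mul_zero]

/-- The rank-one weight family: first row `w` in the first layer, top-left corner `a` in the
hidden layers and `σ * a` in the last layer, all other entries being zero. -/
def cornerFam (m : ℕ) (dims : ℕ → ℕ) (σ a : ℝ) (w : ℕ → ℝ) : WeightFam (m + 2) dims :=
  fun j => Matrix.of fun p q =>
    if p.val = 0 then
      if j.val = 0 then w q.val
      else if q.val = 0 then (if j.val = m + 1 then σ * a else a) else 0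
    else 0

/-- The top-left entry of the layer `j` (zero if it does not exist). -/
def corner {n : ℕ} {dims : ℕ → ℕ} (V : WeightFam n dims) (j : ℕ) : ℝ :=
  if h : j < n ∧ 0 < dims (j + 1) ∧ 0 < dims j then V ⟨j, h.1⟩ ⟨0, h.2.1⟩ ⟨0, h.2.2⟩ else 0

theorem cornerFam_sub {m : ℕ} {dims : ℕ → ℕ} (σ a η g : ℝ) (w h : ℕ → ℝ) :
    cornerFam m dims σ a w - η • cornerFam m dims σ g h =
      cornerFam m dims σ (a - η * g) (fun q => w q - η * h q) := by
  funext j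
  ext p q
  simp only [cornerFam, Pi.sub_apply, Pi.smul_apply, Matrix.sub_apply, Matrix.smul_apply,
    Matrix.of_apply, smul_eq_mul]
  split_ifs <;> ring

theorem sum_cornerFam_mul {m : ℕ} {dims : ℕ → ℕ} (hpos : ∀ j ≤ m + 2, 0 < dims j)
    (σ g : ℝ) (h : ℕ → ℝ) (V : WeightFam (m + 2) dims) :
    ∑ j : Fin (m + 2), ∑ p : Fin (dims (j.val + 1)), ∑ q : Fin (dims j.val),
        cornerFam m dims σ g h j p q * V j p q =
      ∑ q : Fin (dims 0), h q * V ⟨0, by omega⟩ ⟨0, hpos 1 (by omega)⟩ q +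
        g * (∑ j ∈ Finset.range m, corner V (j + 1) + σ * corner V (m + 1)) := by
  set F : ℕ → ℝ := fun j =>
    if j = 0 then ∑ q : Fin (dims 0), h q * V ⟨0, by omega⟩ ⟨0, hpos 1 (by omega)⟩ q
    else (if j = m + 1 then σ * g else g) * corner V j with hF
  have key : ∀ j : Fin (m + 2), ∑ p : Fin (dims (j.val + 1)), ∑ q : Fin (dims j.val),
      cornerFam m dims σ g h j p q * V j p q = F j.val := by
    rintro ⟨j, hj⟩
    rw [Finset.sum_eq_single ⟨0, hpos (j + 1) (by omega)⟩
      (fun p _ hp => Finset.sum_eq_zero fun q _ => by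
        have : p.val ≠ 0 := fun h0 => hp (Fin.ext h0)
        simp [cornerFam, this]) (by simp)]
    by_cases hj0 : j = 0
    · subst hj0
      simp [cornerFam, hF]
    · rw [Finset.sum_eq_single ⟨0, hpos j (by omega)⟩
        (fun q _ hq => by
          have : q.val ≠ 0 := fun h0 => hq (Fin.ext h0)
          simp [cornerFam, this, hj0]) (by simp)]
      simp [cornerFam, hF, hj0, corner, hj, hpos (j + 1) (by omega), hpos j (by omega)]
  rw [Finset.sum_congr rfl fun j _ => key j, Fin.sum_univ_eq_sum_range F (m + 2),
    Finset.sum_range_succ, Finset.sum_range_succ']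
  have hmid : ∀ j ∈ Finset.range m, F (j + 1) = g * corner V (j + 1) := fun j hj => by
    have := Finset.mem_range.1 hj
    simp [hF, show j ≠ m by omega]
  rw [Finset.sum_congr rfl hmid, ← Finset.mul_sum]
  simp only [hF, if_pos, if_neg (Nat.succ_ne_zero m)]
  ring

theorem segProd_cornerFam_apply {m : ℕ} {dims : ℕ → ℕ} (hpos : ∀ j ≤ m + 2, 0 < dims j)
    (σ a : ℝ) (w : ℕ → ℝ) {c : ℕ} (hc : c ≤ m) (i : Fin (dims (c + 1))) (q : Fin (dims 0)) :
    segProd dims (cornerFam m dims σ a w) 0 (c + 1) i q =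
      if i.val = 0 then a ^ c * w q else 0 := by
  induction c with
  | zero =>
    refine (congrFun₂ (segProd_one dims (cornerFam m dims σ a w) (by omega)) i q).trans ?_
    simp [cornerFam]
  | succ c ih =>
    rw [segProd_succ dims _ (show c + 1 < m + 2 by omega), Matrix.mul_apply,
      Finset.sum_eq_single ⟨0, hpos (c + 1) (by omega)⟩
        (fun r _ hr => by
          have : r.val ≠ 0 := fun h0 => hr (Fin.ext h0)
          simp [cornerFam, this]) (by simp), ih (by omega)]
    simp only [cornerFam, Matrix.of_apply, if_true, if_neg (Nat.succ_ne_zero c),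
      if_neg (show c + 1 ≠ m + 1 by omega)]
    split_ifs <;> ring

theorem segProd_cornerFam_top_apply {m : ℕ} {dims : ℕ → ℕ} (hpos : ∀ j ≤ m + 2, 0 < dims j)
    (σ a : ℝ) (w : ℕ → ℝ) (i : Fin (dims (m + 2))) (hi : i.val = 0) (q : Fin (dims 0)) :
    segProd dims (cornerFam m dims σ a w) 0 (m + 2) i q = σ * (a ^ m * a * w q) := by
  rw [segProd_succ dims _ (show m + 1 < m + 2 by omega), Matrix.mul_apply,
    Finset.sum_eq_single ⟨0, hpos (m + 1) (by omega)⟩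
      (fun r _ hr => by
        have : r.val ≠ 0 := fun h0 => hr (Fin.ext h0)
        simp [cornerFam, this]) (by simp),
    segProd_cornerFam_apply hpos σ a w le_rfl]
  simp [cornerFam, hi]
  ring

section Gradient

variable {E : Type*} [NormedAddCommGroup E] [InnerProductSpace ℝ E] [FiniteDimensional ℝ E]

theorem hasFDerivAt_entry {n : ℕ} {dims : ℕ → ℕ} (arr : E →ₗ[ℝ] WeightFam n dims) (θ : E)
    (j : Fin n) (p : Fin (dims (j.val + 1))) (q : Fin (dims j.val)) :
    ∃ L : E →L[ℝ] ℝ, HasFDerivAt (fun θ => arr θ j p q) L θ ∧ ∀ v, L v = arr v j p q := by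
  let l : E →ₗ[ℝ] ℝ :=
    { toFun := fun v => arr v j p q
      map_add' := fun x y => by simp
      map_smul' := fun c x => by simp }
  exact ⟨l.toContinuousLinearMap, l.toContinuousLinearMap.hasFDerivAt, fun v => rfl⟩

theorem hasFDerivAt_segProd_succ {n : ℕ} {dims : ℕ → ℕ} (arr : E →ₗ[ℝ] WeightFam n dims) (θ : E)
    {b : ℕ} (hb : b < n) (q : Fin (dims 0)) {L : Fin (dims b) → E →L[ℝ] ℝ}
    (hL : ∀ r, HasFDerivAt (fun θ => segProd dims (arr θ) 0 b r q) (L r) θ)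
    (i : Fin (dims (b + 1))) :
    ∃ L' : E →L[ℝ] ℝ, HasFDerivAt (fun θ => segProd dims (arr θ) 0 (b + 1) i q) L' θ ∧
      ∀ v, L' v = ∑ r, (arr θ ⟨b, hb⟩ i r * L r v +
        segProd dims (arr θ) 0 b r q * arr v ⟨b, hb⟩ i r) := by
  choose l hl hlv using fun r => hasFDerivAt_entry arr θ ⟨b, hb⟩ i r
  refine ⟨∑ r, (arr θ ⟨b, hb⟩ i r • L r + segProd dims (arr θ) 0 b r q • l r), ?_, fun v => ?_⟩
  · simp only [segProd_succ dims _ hb, Matrix.mul_apply]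
    exact HasFDerivAt.fun_sum fun r _ => (hl r).mul (hL r)
  · simp [hlv]

theorem hasFDerivAt_segProd_cornerFam {m : ℕ} {dims : ℕ → ℕ}
    (hpos : ∀ j ≤ m + 2, 0 < dims j) (arr : E →ₗ[ℝ] WeightFam (m + 2) dims) {θ : E}
    {σ a : ℝ} {w : ℕ → ℝ} (hθ : arr θ = cornerFam m dims σ a w) (q : Fin (dims 0))
    {c : ℕ} (hc : c ≤ m) :
    ∃ L : Fin (dims (c + 1)) → E →L[ℝ] ℝ,
      (∀ i, HasFDerivAt (fun θ => segProd dims (arr θ) 0 (c + 1) i q) (L i) θ) ∧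
      ∀ v, a * L ⟨0, hpos (c + 1) (by omega)⟩ v =
        a ^ (c + 1) * arr v ⟨0, by omega⟩ ⟨0, hpos 1 (by omega)⟩ q +
          a ^ c * w q * ∑ j ∈ Finset.range c, corner (arr v) (j + 1) := by
  induction c with
  | zero =>
    choose L hL hLv using fun i : Fin (dims (0 + 1)) =>
      hasFDerivAt_entry arr θ (⟨0, by omega⟩ : Fin (m + 2)) i q
    refine ⟨L, fun i => ?_, fun v => ?_⟩
    · have h1 : (fun θ => segProd dims (arr θ) 0 (0 + 1) i q) =
          fun θ => arr θ ⟨0, by omega⟩ i q :=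
        funext fun θ' => congrFun₂ (segProd_one dims (arr θ') (by omega)) i q
      rw [h1]
      exact hL i
    · rw [hLv]; simp
  | succ c ih =>
    obtain ⟨L, hL, hLv⟩ := ih (by omega)
    choose L' hL' hLv' using hasFDerivAt_segProd_succ arr θ (show c + 1 < m + 2 by omega) q hL
    refine ⟨L', hL', fun v => ?_⟩
    rw [hLv', Finset.sum_eq_single ⟨0, hpos (c + 1) (by omega)⟩
      (fun r _ hr => by
        have : r.val ≠ 0 := fun h0 => hr (Fin.ext h0)
        rw [hθ, segProd_cornerFam_apply hpos σ a w (by omega)]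
        simp [cornerFam, this]) (by simp), hθ, segProd_cornerFam_apply hpos σ a w (by omega),
      Finset.sum_range_succ]
    have hcor : corner (arr v) (c + 1) = arr v ⟨c + 1, by omega⟩
        ⟨0, hpos (c + 2) (by omega)⟩ ⟨0, hpos (c + 1) (by omega)⟩ := by
      rw [corner, dif_pos ⟨by omega, hpos _ (by omega), hpos _ (by omega)⟩]
    have h0 : cornerFam m dims σ a w ⟨c + 1, by omega⟩
        ⟨0, hpos (c + 2) (by omega)⟩ ⟨0, hpos (c + 1) (by omega)⟩ = a := by
      simp [cornerFam, show c ≠ m by omega]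
    rw [h0, hcor, mul_add, hLv]
    simp only [if_true]
    ring

theorem hasFDerivAt_segProd_cornerFam_top {m : ℕ} {dims : ℕ → ℕ}
    (hpos : ∀ j ≤ m + 2, 0 < dims j) (arr : E →ₗ[ℝ] WeightFam (m + 2) dims) {θ : E}
    {σ a : ℝ} {w : ℕ → ℝ} (hθ : arr θ = cornerFam m dims σ a w) (q : Fin (dims 0))
    (i : Fin (dims (m + 2))) (hi : i.val = 0) :
    ∃ L : E →L[ℝ] ℝ, HasFDerivAt (fun θ => segProd dims (arr θ) 0 (m + 2) i q) L θ ∧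
      ∀ v, L v = σ * (a ^ m * a * arr v ⟨0, by omega⟩ ⟨0, hpos 1 (by omega)⟩ q) +
        a ^ m * w q * (corner (arr v) (m + 1) +
          σ * ∑ j ∈ Finset.range m, corner (arr v) (j + 1)) := by
  obtain ⟨L, hL, hLv⟩ := hasFDerivAt_segProd_cornerFam hpos arr hθ q le_rfl
  obtain ⟨L', hL', hLv'⟩ :=
    hasFDerivAt_segProd_succ arr θ (show m + 1 < m + 2 by omega) q hL i
  refine ⟨L', hL', fun v => ?_⟩
  obtain rfl : i = ⟨0, hpos (m + 2) le_rfl⟩ := Fin.ext hi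
  rw [hLv', Finset.sum_eq_single ⟨0, hpos (m + 1) (by omega)⟩
    (fun r _ hr => by
      have : r.val ≠ 0 := fun h0 => hr (Fin.ext h0)
      rw [hθ, segProd_cornerFam_apply hpos σ a w le_rfl]
      simp [cornerFam, this]) (by simp), hθ, segProd_cornerFam_apply hpos σ a w le_rfl]
  have hcor : corner (arr v) (m + 1) = arr v ⟨m + 1, by omega⟩
      ⟨0, hpos (m + 2) le_rfl⟩ ⟨0, hpos (m + 1) (by omega)⟩ := by
    rw [corner, dif_pos ⟨by omega, hpos _ (by omega), hpos _ (by omega)⟩]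
  have h0 : cornerFam m dims σ a w ⟨m + 1, by omega⟩
      ⟨0, hpos (m + 2) le_rfl⟩ ⟨0, hpos (m + 1) (by omega)⟩ = σ * a := by
    simp [cornerFam]
  rw [h0, hcor, mul_assoc σ, hLv]
  simp only [if_true]
  ring

theorem frobNorm_sq {p q : ℕ} (hp : p = 1) (M : Matrix (Fin p) (Fin q) ℝ) (i : Fin p) :
    frobNorm M ^ 2 = ∑ j, M i j ^ 2 := by
  subst hp
  rw [frobNorm, Real.sq_sqrt (by positivity), Fin.sum_univ_one, Subsingleton.elim i 0]

theorem arr_gradient_eq_cornerFam [CompleteSpace E] {m : ℕ} {dims : ℕ → ℕ}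
    (hdn : dims (m + 2) = 1) (hpos : ∀ j ≤ m + 2, 0 < dims j)
    {arr : E →ₗ[ℝ] WeightFam (m + 2) dims} (harr : Function.Surjective arr)
    (hinner : ∀ u v : E, ⟪u, v⟫ =
      ∑ j : Fin (m + 2), ∑ p : Fin (dims (j.val + 1)), ∑ q : Fin (dims j.val),
        arr u j p q * arr v j p q)
    {Lyx : Matrix (Fin (dims (m + 2))) (Fin (dims 0)) ℝ} {f : E → ℝ} {C : ℝ}
    (hf : ∀ θ, f θ = 1 / 2 * frobNorm (segProd dims (arr θ) 0 (m + 2) - Lyx) ^ 2 + C)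
    {σ a : ℝ} {w l : ℕ → ℝ} (hσ : σ ^ 2 = 1)
    (hl : ∀ q : Fin (dims 0), l q = σ * Lyx ⟨0, hpos _ le_rfl⟩ q)
    {θ : E} (hθ : arr θ = cornerFam m dims σ a w) :
    arr (gradient f θ) = cornerFam m dims σ
      (a ^ m * ∑ q : Fin (dims 0), (a ^ m * a * w q - l q) * w q)
      (fun q => a ^ m * a * (a ^ m * a * w q - l q)) := by
  obtain ⟨G, hG⟩ := harr (cornerFam m dims σ
      (a ^ m * ∑ q : Fin (dims 0), (a ^ m * a * w q - l q) * w q)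
      (fun q => a ^ m * a * (a ^ m * a * w q - l q)))
  choose L hL hLv using fun q =>
    hasFDerivAt_segProd_cornerFam_top hpos arr hθ q ⟨0, hpos _ le_rfl⟩ rfl
  have hfe : f = fun θ => 1 / 2 * (∑ q : Fin (dims 0),
      (segProd dims (arr θ) 0 (m + 2) ⟨0, hpos _ le_rfl⟩ q - Lyx ⟨0, hpos _ le_rfl⟩ q) ^ 2)
        + C := by
    funext θ
    rw [hf, frobNorm_sq hdn _ ⟨0, hpos _ le_rfl⟩]
    rfl
  have hgrad : HasGradientAt f G θ := by
    rw [hasGradientAt_iff_hasFDerivAt, hfe]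
    have hd := ((HasFDerivAt.fun_sum (u := Finset.univ) fun q _ =>
      ((hL q).sub_const (Lyx ⟨0, hpos _ le_rfl⟩ q)).pow 2).const_mul (1 / 2)).add_const C
    refine hd.congr_fderiv ?_
    ext v
    rw [InnerProductSpace.toDual_apply_apply, hinner, hG, sum_cornerFam_mul hpos]
    simp only [_root_.smul_apply, _root_.sum_apply, smul_eq_mul, hLv,
      hθ, segProd_cornerFam_top_apply hpos σ a w ⟨0, hpos _ le_rfl⟩ rfl]
    generalize ∑ j ∈ Finset.range m, corner (arr v) (j + 1) = c
    rw [mul_assoc (a ^ m), Finset.sum_mul, Finset.mul_sum, Finset.mul_sum,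
      ← Finset.sum_add_distrib]
    refine Finset.sum_congr rfl fun q _ => ?_
    have hlq : Lyx ⟨0, hpos _ le_rfl⟩ q = σ * l q := by
      rw [hl, ← mul_assoc, ← sq, hσ, one_mul]
    rw [hlq, nsmul_eq_mul]
    push_cast
    linear_combination (a ^ m * a * w q - l q) *
      (a ^ m * a * arr v ⟨0, by omega⟩ ⟨0, hpos 1 (by omega)⟩ q + a ^ m * w q * c) * hσ
  rw [hgrad.gradient, hG]

end Gradient

section Iterates

variable {E : Type*} [NormedAddCommGroup E] [InnerProductSpace ℝ E] [FiniteDimensional ℝ E]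
  [CompleteSpace E]

theorem exists_cornerFam_gdIter {m : ℕ} {dims : ℕ → ℕ}
    (hdn : dims (m + 2) = 1) (hpos : ∀ j ≤ m + 2, 0 < dims j)
    {arr : E →ₗ[ℝ] WeightFam (m + 2) dims} (harr : Function.Surjective arr)
    (hinner : ∀ u v : E, ⟪u, v⟫ =
      ∑ j : Fin (m + 2), ∑ p : Fin (dims (j.val + 1)), ∑ q : Fin (dims j.val),
        arr u j p q * arr v j p q)
    {Lyx : Matrix (Fin (dims (m + 2))) (Fin (dims 0)) ℝ} {f : E → ℝ} {C : ℝ}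
    (hf : ∀ θ, f θ = 1 / 2 * frobNorm (segProd dims (arr θ) 0 (m + 2) - Lyx) ^ 2 + C)
    {σ a₀ : ℝ} {w₀ l : ℕ → ℝ} (hσ : σ ^ 2 = 1)
    (hl : ∀ q : Fin (dims 0), l q = σ * Lyx ⟨0, hpos _ le_rfl⟩ q)
    {θ₀ : E} (hθ₀ : arr θ₀ = cornerFam m dims σ a₀ w₀) (η : ℝ) :
    ∃ (a : ℕ → ℝ) (w : ℕ → ℕ → ℝ), a 0 = a₀ ∧ w 0 = w₀ ∧
      (∀ k, arr (gdIter f η θ₀ k) = cornerFam m dims σ (a k) (w k)) ∧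
      (∀ k, a (k + 1) = a k - η *
        (a k ^ m * ∑ q : Fin (dims 0), (a k ^ m * a k * w k q - l q) * w k q)) ∧
      ∀ k q, w (k + 1) q = w k q - η * (a k ^ m * a k * (a k ^ m * a k * w k q - l q)) := by
  let aw : ℕ → ℝ × (ℕ → ℝ) := fun k => Nat.rec (a₀, w₀) (fun _ x =>
    (x.1 - η * (x.1 ^ m * ∑ q : Fin (dims 0), (x.1 ^ m * x.1 * x.2 q - l q) * x.2 q),
      fun q => x.2 q - η * (x.1 ^ m * x.1 * (x.1 ^ m * x.1 * x.2 q - l q)))) k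
  refine ⟨fun k => (aw k).1, fun k => (aw k).2, rfl, rfl, fun k => ?_, fun k => rfl,
    fun k q => rfl⟩
  induction k with
  | zero => exact hθ₀
  | succ k ih =>
    rw [gdIter, map_sub, map_smul, arr_gradient_eq_cornerFam hdn hpos harr hinner hf hσ hl ih, ih,
      cornerFam_sub]

theorem gdIter_loss_le_of_cornerFam {m : ℕ} {dims : ℕ → ℕ}
    (hdn : dims (m + 2) = 1) (hpos : ∀ j ≤ m + 2, 0 < dims j)
    {arr : E →ₗ[ℝ] WeightFam (m + 2) dims} (harr : Function.Surjective arr)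
    (hinner : ∀ u v : E, ⟪u, v⟫ =
      ∑ j : Fin (m + 2), ∑ p : Fin (dims (j.val + 1)), ∑ q : Fin (dims j.val),
        arr u j p q * arr v j p q)
    {Lyx : Matrix (Fin (dims (m + 2))) (Fin (dims 0)) ℝ} {f : E → ℝ} {C : ℝ}
    (hf : ∀ θ, f θ = 1 / 2 * frobNorm (segProd dims (arr θ) 0 (m + 2) - Lyx) ^ 2 + C)
    {σ a₀ : ℝ} {w₀ l : ℕ → ℝ} (hσ : σ ^ 2 = 1)
    (hl : ∀ q : Fin (dims 0), l q = σ * Lyx ⟨0, hpos _ le_rfl⟩ q)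
    (hl1 : ∑ q : Fin (dims 0), l q ^ 2 = 1)
    {θ₀ : E} (hθ₀ : arr θ₀ = cornerFam m dims σ a₀ w₀)
    {η ν s ε : ℝ} (ha₀ : 0 < a₀) (hs : a₀ ^ (m + 2) = s) (hs1 : s ≤ 1 / 5)
    (hp₀ : ∑ q : Fin (dims 0), l q * w₀ q = ν * a₀)
    (hw₀ : ∑ q : Fin (dims 0), w₀ q ^ 2 = a₀ ^ 2)
    (hν : -1 < ν) (hν1 : ν ≤ 1) (hε : 0 < ε) (hε1 : ε ≤ 1) (hη : 0 < η)
    {n : ℕ} (hn : n = m + 2) {R M L : ℝ} (hR : R = (1 - ν) / (1 + ν)) (hM : M = max 1 R)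
    (hL : L = Real.log (15 * (n : ℝ) * M / (s * ε)))
    (hηle : η ≤ s ^ 5 * ε / ((n : ℝ) ^ ((17 : ℝ) / 2) * Real.exp (7 * (n : ℝ) + 6) *
      M ^ ((11 * (n : ℝ) - 5) / 2)) / L ^ 2)
    {K : ℕ} (hK : K = ⌊2 * (n : ℝ) * (max 1 (3 / 2 * R)) ^ n / (s * η) * L + 1⌋₊) :
    f (gdIter f η θ₀ K) - C ≤ ε := by
  obtain ⟨a, w, rfl, rfl, hθ, ha, hw⟩ :=
    exists_cornerFam_gdIter hdn hpos harr hinner hf hσ hl hθ₀ η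
  set p : ℕ → ℝ := fun k => ∑ q : Fin (dims 0), l q * w k q with hp
  set D : ℕ → ℝ := fun k => ∑ q : Fin (dims 0), w k q ^ 2 - a k ^ 2 with hD
  have hres : ∀ (k : ℕ) (b : ℝ), ∑ q : Fin (dims 0), (b * w k q - l q) * w k q =
      b * (a k ^ 2 + D k) - p k := fun k b => by
    rw [hD, hp]
    simp only [add_sub_cancel]
    rw [Finset.mul_sum, ← Finset.sum_sub_distrib]
    exact Finset.sum_congr rfl fun q _ => by ring
  have hlres : ∀ (k : ℕ) (b : ℝ), ∑ q : Fin (dims 0), l q * (b * w k q - l q) =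
      b * p k - 1 := fun k b => by
    rw [hp, ← hl1, Finset.mul_sum, ← Finset.sum_sub_distrib]
    exact Finset.sum_congr rfl fun q _ => by ring
  have hsq : ∀ (k : ℕ) (b : ℝ), ∑ q : Fin (dims 0), (b * w k q - l q) ^ 2 =
      b ^ 2 * (a k ^ 2 + D k) - 2 * b * p k + 1 := fun k b => by
    have h1 : ∑ q : Fin (dims 0), (b * w k q - l q) ^ 2 =
        b * ∑ q : Fin (dims 0), (b * w k q - l q) * w k q -
          ∑ q : Fin (dims 0), l q * (b * w k q - l q) := by
      rw [Finset.mul_sum, ← Finset.sum_sub_distrib]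
      exact Finset.sum_congr rfl fun q _ => by ring
    rw [h1, hres, hlres]
    ring
  have ha' : ∀ k, a (k + 1) =
      a k - η * (a k ^ m * (a k ^ m * a k * (a k ^ 2 + D k) - p k)) := fun k => by
    rw [ha, hres]
  have hmain := scalar_gd_loss_le (p := p) (D := D) ha₀ hs hs1 hp₀ (by simp [hD, hw₀]) hν hν1 hε
    hε1 hη ha' (fun k => ?_) (fun k => ?_) hn hR hM hL hηle hK
  · rw [← hsq] at hmain
    refine le_of_eq_of_le ?_ hmain
    rw [hf, hθ, frobNorm_sq hdn _ ⟨0, hpos _ le_rfl⟩, add_sub_cancel_right]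
    congr 1
    refine Finset.sum_congr rfl fun q _ => ?_
    rw [Matrix.sub_apply, segProd_cornerFam_top_apply hpos _ _ _ _ rfl, hl]
    generalize Lyx ⟨0, hpos _ le_rfl⟩ q = y
    linear_combination ((a K ^ m * a K * w K q) ^ 2 - y ^ 2) * hσ
  · rw [← hlres, Finset.mul_sum, Finset.mul_sum]
    simp only [hp, hw]
    rw [← Finset.sum_sub_distrib]
    exact Finset.sum_congr rfl fun q _ => by ring
  · rw [← hsq]
    have h1 : ∑ q : Fin (dims 0), w (k + 1) q ^ 2 = ∑ q : Fin (dims 0), w k q ^ 2 -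
        2 * η * (a k ^ m * a k) *
          ∑ q : Fin (dims 0), (a k ^ m * a k * w k q - l q) * w k q +
        η ^ 2 * (a k ^ m * a k) ^ 2 *
          ∑ q : Fin (dims 0), (a k ^ m * a k * w k q - l q) ^ 2 := by
      rw [Finset.mul_sum, Finset.mul_sum, ← Finset.sum_sub_distrib, ← Finset.sum_add_distrib]
      exact Finset.sum_congr rfl fun q _ => by rw [hw]; ring
    rw [hres] at h1
    have h2 : D (k + 1) = ∑ q : Fin (dims 0), w (k + 1) q ^ 2 - a (k + 1) ^ 2 := rfl
    have h3 : D k = ∑ q : Fin (dims 0), w k q ^ 2 - a k ^ 2 := rfl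
    rw [h2, h1, ha']
    linear_combination -h3

end Iterates

theorem eq_cornerFam_of_padTL {m r : ℕ} {dims : ℕ → ℕ} (hr : r = 1) (hdn : dims (m + 2) = 1)
    {U : Matrix (Fin (dims (m + 2))) (Fin r) ℝ} {S : Matrix (Fin r) (Fin r) ℝ}
    {V : Matrix (Fin (dims 0)) (Fin r) ℝ} {e : ℝ} {W : WeightFam (m + 2) dims}
    (hW : ∀ j : Fin (m + 2), W j =
      if j.val = 0 then padTL (dims (j.val + 1)) (dims j.val) (rpowMat S e * Vᵀ)
      else if j.val = m + 2 - 1 then padTL (dims (j.val + 1)) (dims j.val) (U * rpowMat S e)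
      else padTL (dims (j.val + 1)) (dims j.val) (rpowMat S e)) (i : Fin r)
    (o : Fin (dims (m + 2))) :
    W = cornerFam m dims (U o i) (S i i ^ e)
      (fun q => if h : q < dims 0 then S i i ^ e * V ⟨q, h⟩ i else 0) := by
  subst hr
  obtain rfl := Subsingleton.elim i 0
  have ho : o.val = 0 := by omega
  funext ⟨j, hj⟩
  ext p q
  rw [hW]
  have hS : ∀ x y : Fin 1, S x y = S 0 0 := fun x y => by
    rw [Subsingleton.elim x 0, Subsingleton.elim y 0]
  rcases Nat.eq_zero_or_pos j with rfl | hj0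
  · simp [padTL, cornerFam, rpowMat, Matrix.mul_apply, hS]
  · by_cases hjm : j = m + 1
    · subst hjm
      obtain rfl : p = o := Fin.ext (by have := p.2; simp only [hdn] at this; omega)
      simp [padTL, cornerFam, rpowMat, Matrix.mul_apply, ho, hS, hdn]
    · simp only [padTL, cornerFam, rpowMat, hjm, hj0.ne', Matrix.of_apply, if_false, hS,
        Nat.lt_one_iff, show j ≠ m + 2 - 1 by omega]
      split_ifs <;> simp_all

theorem ae_ne_smul {p q : ℕ} (hpq : 1 < p * q) {P : Measure (MatE p q)}
    (hac : P ≪ (volume : Measure (MatE p q))) (B : MatE p q) :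
    ∀ᵐ A ∂P, ∀ c : ℝ, A ≠ c • B := by
  have hne : Submodule.span ℝ {B} ≠ ⊤ := fun h => by
    have h1 : Module.finrank ℝ (MatE p q) ≤ 1 := finrank_le_one B fun A =>
      Submodule.mem_span_singleton.1 (h ▸ Submodule.mem_top)
    rw [finrank_euclideanSpace, Fintype.card_prod, Fintype.card_fin, Fintype.card_fin] at h1
    omega
  have := hac (Measure.addHaar_submodule volume _ hne)
  filter_upwards [measure_eq_zero_iff_ae_notMem.1 this] with A hA c hc
  exact hA (hc ▸ Submodule.smul_mem _ _ (Submodule.mem_span_singleton_self B))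

theorem sum_mul_le_one_of_sum_sq_eq_one {ι : Type*} [Fintype ι] {x u : ι → ℝ}
    (hx : ∑ q, x q ^ 2 = 1) (hu : ∑ q, u q ^ 2 = 1) : ∑ q, x q * u q ≤ 1 := by
  have h : ∑ q, (x q - u q) ^ 2 = ∑ q, x q ^ 2 - 2 * ∑ q, x q * u q + ∑ q, u q ^ 2 := by
    rw [Finset.mul_sum, ← Finset.sum_sub_distrib, ← Finset.sum_add_distrib]
    exact Finset.sum_congr rfl fun q _ => by ring
  have : 0 ≤ ∑ q, (x q - u q) ^ 2 := Finset.sum_nonneg fun q _ => sq_nonneg _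
  linarith

theorem neg_one_lt_sum_mul_of_sum_sq_eq_one {ι : Type*} [Fintype ι] {x u : ι → ℝ}
    (hx : ∑ q, x q ^ 2 = 1) (hu : ∑ q, u q ^ 2 = 1) (hxu : ∃ q, u q ≠ -x q) :
    -1 < ∑ q, x q * u q := by
  have h : ∑ q, (x q + u q) ^ 2 = ∑ q, x q ^ 2 + 2 * ∑ q, x q * u q + ∑ q, u q ^ 2 := by
    rw [Finset.mul_sum, ← Finset.sum_add_distrib, ← Finset.sum_add_distrib]
    exact Finset.sum_congr rfl fun q _ => by ring
  obtain ⟨q, hq⟩ := hxu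
  have : 0 < ∑ q, (x q + u q) ^ 2 := Finset.sum_pos' (fun q _ => sq_nonneg _)
    ⟨q, Finset.mem_univ q, by
      have : x q + u q ≠ 0 := fun h0 => hq (by linarith)
      positivity⟩
  linarith

theorem frobNorm_toMat {p q : ℕ} (A : MatE p q) : frobNorm (toMat A) = ‖A‖ := by
  rw [EuclideanSpace.norm_eq, frobNorm, Fintype.sum_prod_type]
  simp [toMat]

theorem frobNorm_nonneg {p q : ℕ} (M : Matrix (Fin p) (Fin q) ℝ) : 0 ≤ frobNorm M :=
  Real.sqrt_nonneg _

theorem frobNorm_zero {p q : ℕ} : frobNorm (0 : Matrix (Fin p) (Fin q) ℝ) = 0 := by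
  simp [frobNorm]

theorem ae_norm_le_of_measure_eq_one {p q : ℕ} {P : Measure (MatE p q)} [IsProbabilityMeasure P]
    {c : ℝ} (h : P {A : MatE p q | ‖A‖ ≤ c} = 1) : ∀ᵐ A ∂P, ‖A‖ ≤ c :=
  (mem_ae_iff_prob_eq_one (measurableSet_le measurable_norm measurable_const)).2 h

/-- Corollary 1 of the paper: almost surely with respect to a random
balanced initialization — end-to-end matrix `A` sampled from a probability measure `P`
that vanishes on Lebesgue-null sets and is supported on `{‖A‖_F ≤ 0.2}`, weight matrices
set from a singular value decomposition `A = U Σ Vᵀ` via zero-padding as in Procedure 1 —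
gradient descent with a small enough step size drives the square-loss training loss of a
deep linear network with scalar output to within any `ε' > 0` of the global minimum in an
explicit number of iterations. -/
theorem deep_linear_gradient_descent_converges_almost_surely {n d : ℕ} (hn : 2 ≤ n)
    (dims : ℕ → ℕ) (hdn : dims n = 1) (hd0 : 1 < dims 0)
    (Lyx : Matrix (Fin (dims n)) (Fin (dims 0)) ℝ) (hLyx : frobNorm Lyx = 1)
    (arr : EuclideanSpace ℝ (Fin d) →ₗ[ℝ] WeightFam n dims)
    (harr : Function.Bijective arr)
    (hinner : ∀ u v : EuclideanSpace ℝ (Fin d), ⟪u, v⟫ =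
      ∑ j : Fin n, ∑ p : Fin (dims (j.val + 1)), ∑ q : Fin (dims j.val),
        arr u j p q * arr v j p q)
    (f : EuclideanSpace ℝ (Fin d) → ℝ)
    (hf : ∀ θ', f θ' =
      1 / 2 * frobNorm (segProd dims (arr θ') 0 n - Lyx) ^ 2 + sInf (Set.range f))
    (P : Measure (MatE (dims n) (dims 0))) (hprob : IsProbabilityMeasure P)
    (hac : P ≪ (volume : Measure (MatE (dims n) (dims 0))))
    (hsupp : P {A : MatE (dims n) (dims 0) | ‖A‖ ≤ 0.2} = 1) :
    ∀ᵐ A ∂P, ∀ θ0 : EuclideanSpace ℝ (Fin d),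
      ∀ (U : Matrix (Fin (dims n)) (Fin (min (dims 0) (dims n))) ℝ)
        (S : Matrix (Fin (min (dims 0) (dims n))) (Fin (min (dims 0) (dims n))) ℝ)
        (V : Matrix (Fin (dims 0)) (Fin (min (dims 0) (dims n))) ℝ),
        Uᵀ * U = 1 → Vᵀ * V = 1 →
        (∀ i j, i ≠ j → S i j = 0) → (∀ i, 0 ≤ S i i) →
        toMat A = U * S * Vᵀ →
        (∀ j : Fin n, arr θ0 j =
          if j.val = 0 then
            padTL (dims (j.val + 1)) (dims j.val) (rpowMat S (1 / (n : ℝ)) * Vᵀ)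
          else if j.val = n - 1 then
            padTL (dims (j.val + 1)) (dims j.val) (U * rpowMat S (1 / (n : ℝ)))
          else padTL (dims (j.val + 1)) (dims j.val) (rpowMat S (1 / (n : ℝ)))) →
        ∀ W0 : Matrix (Fin (dims n)) (Fin (dims 0)) ℝ, W0 = segProd dims (arr θ0) 0 n →
        ∀ ν : ℝ, ν = Matrix.trace (Lyxᵀ * W0) / (frobNorm Lyx * frobNorm W0) →
        ∀ ε' : ℝ, 0 < ε' → ∀ η : ℝ, 0 < η →
          η ≤ frobNorm W0 ^ 5 * min 1 ε' /
              ((n : ℝ) ^ ((17 : ℝ) / 2) * Real.exp (7 * (n : ℝ) + 6) *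
                (max 1 ((1 - ν) / (1 + ν))) ^ ((11 * (n : ℝ) - 5) / 2)) /
              Real.log (15 * (n : ℝ) * max 1 ((1 - ν) / (1 + ν)) /
                (frobNorm W0 * min 1 ε')) ^ 2 →
          f (gdIter f η θ0
              ⌊2 * (n : ℝ) * (max 1 (3 / 2 * ((1 - ν) / (1 + ν)))) ^ n /
                  (frobNorm W0 * η) *
                  Real.log (15 * (n : ℝ) * max 1 ((1 - ν) / (1 + ν)) /
                    (frobNorm W0 * min 1 ε')) + 1⌋₊) -
            sInf (Set.range f) ≤ ε' := by
  obtain ⟨m, rfl⟩ : ∃ m, n = m + 2 := ⟨n - 2, by omega⟩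
  filter_upwards [ae_norm_le_of_measure_eq_one hsupp,
    ae_ne_smul (by rw [hdn, one_mul]; exact hd0) hac (WithLp.toLp 2 fun x => Lyx x.1 x.2)]
    with A hA hne
  intro θ0 U S V hU hV _ hSp hASV hW W0 hW0 ν hν ε' hε' η hη hηle
  have hF0 : frobNorm W0 ≠ 0 := fun h => by
    rw [h] at hηle
    simp only [ne_eq, OfNat.ofNat_ne_zero, not_false_eq_true, zero_pow, zero_mul, zero_div]
      at hηle
    linarith
  have hpos : ∀ j ≤ m + 2, 0 < dims j := by
    intro j hj
    by_contra! h0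
    have h0 : dims j = 0 := by omega
    have hjn : j < m + 2 := lt_of_le_of_ne hj fun h => by rw [h] at h0; omega
    have hz : arr θ0 ⟨j, hjn⟩ = 0 := by
      ext p q
      exact (Fin.cast h0 q).elim0
    refine hF0 ?_
    rw [hW0, segProd_eq_zero_of_layer_eq_zero hjn hz hjn le_rfl, frobNorm_zero]
  have hr : min (dims 0) (dims (m + 2)) = 1 := by rw [hdn]; omega
  generalize min (dims 0) (dims (m + 2)) = r at U S V hr
  subst hr
  set o : Fin (dims (m + 2)) := ⟨0, hpos _ le_rfl⟩ with ho
  have hoall : ∀ x : Fin (dims (m + 2)), x = o := fun x => Fin.ext (by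
    have := x.2; simp only [hdn] at this; simp [ho]; omega)
  have hsum : ∀ g : Fin (dims (m + 2)) → ℝ, ∑ x, g x = g o := fun g =>
    Finset.sum_eq_single o (fun x _ hx => absurd (hoall x) hx) (by simp)
  have hθ0 := eq_cornerFam_of_padTL rfl hdn hW 0 o
  set s := S 0 0 with hsdef
  set σ := U o 0 with hσdef
  have hs0 : 0 ≤ s := hSp 0
  set a₀ := s ^ (1 / ((m + 2 : ℕ) : ℝ)) with ha₀
  have ha₀0 : 0 ≤ a₀ := Real.rpow_nonneg hs0 _
  have has : a₀ ^ (m + 2) = s := by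
    rw [ha₀, one_div, Real.rpow_inv_natCast_pow hs0 (by omega)]
  have hσ : σ ^ 2 = 1 := by
    have := congrFun₂ hU 0 0
    simp only [Matrix.mul_apply, Matrix.transpose_apply, Matrix.one_apply_eq,
      hsum] at this
    rw [sq]
    exact this
  have hV1 : ∑ q, V q 0 ^ 2 = 1 := by
    have := congrFun₂ hV 0 0
    simp only [Matrix.mul_apply, Matrix.transpose_apply, Matrix.one_apply_eq, ← sq] at this
    exact this
  have hL1 : ∑ q, Lyx o q ^ 2 = 1 := by
    rw [← frobNorm_sq hdn, hLyx, one_pow]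
  have hW0q : ∀ q, W0 o q = σ * (s * V q 0) := fun q => by
    rw [hW0, hθ0, segProd_cornerFam_top_apply hpos _ _ _ _ rfl, dif_pos q.2, ← has]
    ring
  have hAq : ∀ q, A (o, q) = σ * (s * V q 0) := fun q => by
    have := congrFun₂ hASV o q
    simp only [toMat, Matrix.of_apply, Matrix.mul_apply, Fin.sum_univ_one,
      Matrix.transpose_apply] at this
    rw [this, mul_assoc]
  have hWA : W0 = toMat A := by
    ext x q
    rw [hoall x, hW0q, ← hAq]
    rfl
  have hsW : frobNorm W0 = s := by
    rw [← sq_eq_sq₀ (frobNorm_nonneg _) hs0, frobNorm_sq hdn _ o]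
    simp only [hW0q, mul_pow, hσ, one_mul, ← Finset.mul_sum, hV1, mul_one]
  have hs1 : s ≤ 1 / 5 := by
    rw [← hsW, hWA, frobNorm_toMat]
    norm_num at hA ⊢
    exact hA
  rw [hsW] at hF0 hν hηle
  have hspos : 0 < s := lt_of_le_of_ne hs0 (Ne.symm hF0)
  have ha₀pos : 0 < a₀ := lt_of_le_of_ne ha₀0 fun h => hF0 (by rw [← has, ← h]; simp)
  have hν' : ν = ∑ q, Lyx o q * (σ * V q 0) := by
    rw [hν, hLyx, one_mul, div_eq_iff hF0, Finset.sum_mul, Matrix.trace]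
    refine Finset.sum_congr rfl fun q _ => ?_
    rw [Matrix.diag_apply, Matrix.mul_apply, hsum, Matrix.transpose_apply, hW0q]
    ring
  have hu1 : ∑ q, (σ * V q 0) ^ 2 = 1 := by
    simp only [mul_pow, hσ, one_mul, hV1]
  have hν1 : ν ≤ 1 := hν' ▸ sum_mul_le_one_of_sum_sq_eq_one hL1 hu1
  have hν0 : -1 < ν := by
    rw [hν']
    refine neg_one_lt_sum_mul_of_sum_sq_eq_one hL1 hu1 ?_
    by_contra! h
    refine hne (-s) ?_
    ext ⟨x, q⟩
    rw [hoall x, hAq]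
    change _ = -s * Lyx o q
    linear_combination s * h q
  rw [hsW]
  refine le_trans ?_ (min_le_right 1 ε')
  set l : ℕ → ℝ := fun q => if h : q < dims 0 then σ * Lyx o ⟨q, h⟩ else 0
  have hl : ∀ q : Fin (dims 0), l q = σ * Lyx o q := fun q => dif_pos q.2
  refine gdIter_loss_le_of_cornerFam hdn hpos harr.2 hinner hf hσ hl ?_ hθ0 ha₀pos has hs1 ?_ ?_
    hν0 hν1 (lt_min one_pos hε') (min_le_left _ _) hη rfl rfl rfl rfl hηle rfl
  · simp only [hl, mul_pow, hσ, one_mul, hL1]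
  · rw [hν', Finset.sum_mul]
    refine Finset.sum_congr rfl fun q _ => ?_
    rw [hl, dif_pos q.2]
    ring
  · simp only [Fin.is_lt, dif_pos, mul_pow, Fin.eta, ← Finset.mul_sum, hV1, mul_one]
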